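/- Let G be a finite graph with a percolation measure, let A ⊆ vertices of G with |A| = 3 and let 0, b be vertices such that every path in G from 0 to b passes through a vertex of A (A separates 0 from b). Then P(0↔b, 0↔A) ≥ min over a∈A of P(0↔A, a↔b). -/

import Mathlib

open scoped BigOperators

structure PercGraph (V E : Type) where
  ends : E → V × V
  p : E → ℝ

namespace PercGraph

variable {V E : Type} [DecidableEq V] [Fintype E] [DecidableEq E]

/-- Weight of a configuration: each edge `e` is open (`ω e = true`) with probability `p e`. -/
def weight (G : PercGraph V E) (ω : E → Bool) : ℝ :=
  ∏ e, if ω e then G.p e else 1 - G.p e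

/-- Probability of an event under the percolation measure. -/
noncomputable def prob (G : PercGraph V E) (S : Set (E → Bool)) : ℝ :=
  ∑ ω : E → Bool, Set.indicator S G.weight ω

/-- Expectation of a function under the percolation measure. -/
noncomputable def expec (G : PercGraph V E) (f : (E → Bool) → ℝ) : ℝ :=
  ∑ ω : E → Bool, f ω * G.weight ω

/-- Two vertices are adjacent via an open edge in configuration `ω`. -/
def adj (G : PercGraph V E) (ω : E → Bool) (x y : V) : Prop :=
  ∃ e, ω e = true ∧ (G.ends e = (x, y) ∨ G.ends e = (y, x))

/-- `x` and `y` are connected by a path of open edges. -/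
def Conn (G : PercGraph V E) (ω : E → Bool) (x y : V) : Prop :=
  Relation.ReflTransGen (G.adj ω) x y

/-- The union of the open clusters of the vertices of `A`. -/
def cluster (G : PercGraph V E) (ω : E → Bool) (A : Set V) : Set V :=
  {y | ∃ a ∈ A, G.Conn ω a y}

/-- The event `x ↔ y`. -/
def connEvent (G : PercGraph V E) (x y : V) : Set (E → Bool) :=
  {ω | G.Conn ω x y}

/-- The event `x ↔ A`. -/
def connTo (G : PercGraph V E) (x : V) (A : Set V) : Set (E → Bool) :=
  {ω | ∃ a ∈ A, G.Conn ω x a}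

/-- The event `A ↮ B`. -/
def disconn (G : PercGraph V E) (A B : Set V) : Set (E → Bool) :=
  {ω | ∀ a ∈ A, ∀ b ∈ B, ¬ G.Conn ω a b}

def IncreasingEvent (S : Set (E → Bool)) : Prop :=
  ∀ ⦃ω ω' : E → Bool⦄, (∀ e, ω e = true → ω' e = true) → ω ∈ S → ω' ∈ S

def DecreasingEvent (S : Set (E → Bool)) : Prop :=
  ∀ ⦃ω ω' : E → Bool⦄, (∀ e, ω e = true → ω' e = true) → ω' ∈ S → ω ∈ S

def IncreasingFun (f : (E → Bool) → ℝ) : Prop :=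
  ∀ ⦃ω ω' : E → Bool⦄, (∀ e, ω e = true → ω' e = true) → f ω ≤ f ω'

/-- `f` is determined by the cluster of `A`. -/
def ClusterDetermined (G : PercGraph V E) (A : Set V) (f : (E → Bool) → ℝ) : Prop :=
  ∀ ω ω', G.cluster ω A = G.cluster ω' A → f ω = f ω'

/-- The event `S` is determined by the cluster of `A`. -/
def ClusterDeterminedEvent (G : PercGraph V E) (A : Set V) (S : Set (E → Bool)) : Prop :=
  ∀ ω ω', G.cluster ω A = G.cluster ω' A → (ω ∈ S ↔ ω' ∈ S)

noncomputable def condProb (G : PercGraph V E) (S T : Set (E → Bool)) : ℝ :=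
  G.prob (S ∩ T) / G.prob T

noncomputable def condExpec (G : PercGraph V E) (f : (E → Bool) → ℝ) (T : Set (E → Bool)) : ℝ :=
  G.expec (T.indicator f) / G.prob T

/-- The edge `e` is incident to the vertex `x`. -/
def incident (G : PercGraph V E) (x : V) (e : E) : Prop :=
  (G.ends e).1 = x ∨ (G.ends e).2 = x

/-- The other endpoint of an edge incident to `x`. -/
def otherEnd (G : PercGraph V E) (x : V) (e : E) : V :=
  if (G.ends e).1 = x then (G.ends e).2 else (G.ends e).1

/-- The graph `G ∖ W`: delete the vertices of `W` and all incident edges. -/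
def delete (G : PercGraph V E) (W : Finset V) :
    PercGraph V {e : E // (G.ends e).1 ∉ W ∧ (G.ends e).2 ∉ W} :=
  ⟨fun e => G.ends e.1, fun e => G.p e.1⟩

/-- The graph `G` with the probability of edge `e` replaced by `q`. -/
def withEdgeProb (G : PercGraph V E) (e : E) (q : ℝ) : PercGraph V E :=
  ⟨G.ends, Function.update G.p e q⟩

/-- Contraction of the edge `e`: set its probability to 1. -/
def contract (G : PercGraph V E) (e : E) : PercGraph V E :=
  G.withEdgeProb e 1

/-- The event that `e` is pivotal for `U`. -/
def pivotal (e : E) (U : Set (E → Bool)) : Set (E → Bool) :=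
  {ω | ¬ ((Function.update ω e true ∈ U) ↔ (Function.update ω e false ∈ U))}

/-- All edge probabilities lie in `[0,1]`. -/
def ProbValid (G : PercGraph V E) : Prop := ∀ e, 0 ≤ G.p e ∧ G.p e ≤ 1

end PercGraph

namespace PercGraph

set_option linter.unusedSectionVars false

section Expectation

variable {V E : Type} [Fintype E] [DecidableEq E]

/-- The configuration equal to `η` on `J` and to `ω` off `J`. -/
noncomputable def mix (J : Set E) (η ω : E → Bool) : E → Bool :=
  open Classical in fun e => if e ∈ J then η e else ω e

/-- The configuration `ω` with all edges of `J` closed. -/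
noncomputable def close (J : Set E) (ω : E → Bool) : E → Bool := mix J ⊥ ω

/-- The indicator of a proposition, as a real number. -/
noncomputable def ind (P : Prop) : ℝ := open Classical in if P then 1 else 0

theorem ind_of {P : Prop} (h : P) : ind P = 1 := by simp [ind, h]

theorem ind_of_not {P : Prop} (h : ¬ P) : ind P = 0 := by simp [ind, h]

theorem ind_nonneg (P : Prop) : 0 ≤ ind P := by
  unfold ind; split_ifs <;> norm_num

theorem ind_le_one (P : Prop) : ind P ≤ 1 := by
  unfold ind; split_ifs <;> norm_num

theorem ind_mono {P Q : Prop} (h : P → Q) : ind P ≤ ind Q := by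
  by_cases hP : P
  · rw [ind_of hP, ind_of (h hP)]
  · rw [ind_of_not hP]; exact ind_nonneg Q

theorem ind_and (P Q : Prop) : ind (P ∧ Q) = ind P * ind Q := by
  by_cases hP : P <;> by_cases hQ : Q <;> simp [ind, hP, hQ]

theorem mix_mix (J : Set E) (η ω : E → Bool) : mix J (mix J η ω) (mix J ω η) = η := by
  funext e; by_cases h : e ∈ J <;> simp [mix, h]

theorem weight_nonneg {G : PercGraph V E} (hp : G.ProbValid) (ω : E → Bool) :
    0 ≤ G.weight ω := by
  refine Finset.prod_nonneg fun e _ => ?_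
  have := hp e
  split_ifs <;> linarith

theorem sum_weight (G : PercGraph V E) : ∑ ω : E → Bool, G.weight ω = 1 := by
  unfold weight
  rw [← Fintype.prod_sum (fun (e : E) (b : Bool) => if b then G.p e else 1 - G.p e)]
  simp

theorem weight_mix_mul (G : PercGraph V E) (J : Set E) (η ω : E → Bool) :
    G.weight (mix J η ω) * G.weight (mix J ω η) = G.weight η * G.weight ω := by
  unfold weight
  rw [← Finset.prod_mul_distrib, ← Finset.prod_mul_distrib]
  refine Finset.prod_congr rfl fun e _ => ?_
  by_cases h : e ∈ J
  · simp [mix, h]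
  · simp [mix, h, mul_comm]

theorem expec_add (G : PercGraph V E) (f g : (E → Bool) → ℝ) :
    G.expec (fun ω => f ω + g ω) = G.expec f + G.expec g := by
  simp [expec, add_mul, Finset.sum_add_distrib]

theorem expec_sub (G : PercGraph V E) (f g : (E → Bool) → ℝ) :
    G.expec (fun ω => f ω - g ω) = G.expec f - G.expec g := by
  simp [expec, sub_mul, Finset.sum_sub_distrib]

theorem expec_const_mul (G : PercGraph V E) (c : ℝ) (f : (E → Bool) → ℝ) :
    G.expec (fun ω => c * f ω) = c * G.expec f := by
  simp [expec, Finset.mul_sum, mul_assoc]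

theorem expec_const (G : PercGraph V E) (c : ℝ) : G.expec (fun _ => c) = c := by
  simp [expec, ← Finset.mul_sum, sum_weight]

theorem expec_mono {G : PercGraph V E} (hp : G.ProbValid) {f g : (E → Bool) → ℝ}
    (h : ∀ ω, f ω ≤ g ω) : G.expec f ≤ G.expec g :=
  Finset.sum_le_sum fun ω _ => mul_le_mul_of_nonneg_right (h ω) (weight_nonneg hp ω)

theorem expec_nonneg {G : PercGraph V E} (hp : G.ProbValid) {f : (E → Bool) → ℝ}
    (h : ∀ ω, 0 ≤ f ω) : 0 ≤ G.expec f :=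
  Finset.sum_nonneg fun ω _ => mul_nonneg (h ω) (weight_nonneg hp ω)

theorem expec_sub_mul_nonneg {G : PercGraph V E} (hp : G.ProbValid) {f : (E → Bool) → ℝ}
    (h : ∀ ω, 0 ≤ f ω) (η : E → Bool) : f η * G.weight η ≤ G.expec f :=
  Finset.single_le_sum (f := fun ω => f ω * G.weight ω)
    (fun ω _ => mul_nonneg (h ω) (weight_nonneg hp ω)) (Finset.mem_univ η)

theorem prob_eq_expec (G : PercGraph V E) (S : Set (E → Bool)) :
    G.prob S = G.expec fun ω => ind (ω ∈ S) := by
  unfold prob expec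
  refine Finset.sum_congr rfl fun ω _ => ?_
  by_cases h : ω ∈ S <;> simp [ind, h]

/-- Two independent copies may be exchanged on a set of edges revealed by the first copy. -/
theorem expec_expec_mix (G : PercGraph V E) (J : (E → Bool) → Set E)
    (hJ : ∀ η ω, J (mix (J η) η ω) = J η) (Φ : (E → Bool) → ℝ) :
    G.expec (fun η => G.expec fun ω => Φ (mix (J η) η ω)) = G.expec Φ := by
  let σ : (E → Bool) × (E → Bool) → (E → Bool) × (E → Bool) :=
    fun x => (mix (J x.1) x.1 x.2, mix (J x.1) x.2 x.1)
  have hσ : Function.Involutive σ := by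
    rintro ⟨η, ω⟩
    simp only [σ, hJ, mix_mix]
  have h1 : G.expec (fun η => G.expec fun ω => Φ (mix (J η) η ω)) =
      ∑ x : (E → Bool) × (E → Bool), Φ (σ x).1 * (G.weight x.1 * G.weight x.2) := by
    rw [Fintype.sum_prod_type]
    unfold expec
    refine Finset.sum_congr rfl fun η _ => ?_
    rw [Finset.sum_mul]
    refine Finset.sum_congr rfl fun ω _ => ?_
    simp only [σ]; ring
  have h2 : ∑ x : (E → Bool) × (E → Bool), Φ (σ x).1 * (G.weight x.1 * G.weight x.2) =
      ∑ x : (E → Bool) × (E → Bool), Φ x.1 * (G.weight x.1 * G.weight x.2) := by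
    refine Fintype.sum_equiv hσ.toPerm _ _ fun x => ?_
    change _ = Φ (σ x).1 * (G.weight (σ x).1 * G.weight (σ x).2)
    rw [weight_mix_mul]
  rw [h1, h2, Fintype.sum_prod_type]
  unfold expec
  refine Finset.sum_congr rfl fun η _ => ?_
  simp only
  rw [← Finset.mul_sum, ← Finset.mul_sum, sum_weight, mul_one]

/-- Functions of disjoint sets of edges are independent. -/
theorem expec_mul_of_disjoint (G : PercGraph V E) (M : Set E) {f g : (E → Bool) → ℝ}
    (hf : ∀ η ω, f (mix M η ω) = f η) (hg : ∀ η ω, g (mix M η ω) = g ω) :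
    G.expec (fun ω => f ω * g ω) = G.expec f * G.expec g := by
  rw [← expec_expec_mix G (fun _ => M) (fun _ _ => rfl)]
  simp only [hf, hg, expec_const_mul]
  simp only [mul_comm _ (G.expec g), expec_const_mul]

theorem weight_mul_weight_le {G : PercGraph V E} (a b : E → Bool) :
    G.weight a * G.weight b ≤ G.weight (a ⊓ b) * G.weight (a ⊔ b) := by
  unfold weight
  rw [← Finset.prod_mul_distrib, ← Finset.prod_mul_distrib]
  refine (Finset.prod_congr rfl fun e _ => ?_).le
  cases ha : a e <;> cases hb : b e <;> simp [ha, hb, mul_comm]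

/-- Harris' inequality. -/
theorem expec_mul_expec_le_of_monotone {G : PercGraph V E} (hp : G.ProbValid)
    {f g : (E → Bool) → ℝ} (hf : Monotone f) (hg : Monotone g) :
    G.expec f * G.expec g ≤ G.expec fun ω => f ω * g ω := by
  have key := fkg (fun ω => f ω - f ⊥) (fun ω => g ω - g ⊥) G.weight
    (fun ω => weight_nonneg hp ω) (fun ω => sub_nonneg.2 (hf bot_le))
    (fun ω => sub_nonneg.2 (hg bot_le)) (fun a b h => sub_le_sub_right (hf h) _)
    (fun a b h => sub_le_sub_right (hg h) _) weight_mul_weight_le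
  have e (F : (E → Bool) → ℝ) : ∑ ω, G.weight ω * F ω = G.expec F :=
    Finset.sum_congr rfl fun ω _ => mul_comm _ _
  rw [e, e, e, sum_weight, expec_sub, expec_sub, expec_const, expec_const] at key
  have e2 : G.expec (fun ω => (f ω - f ⊥) * (g ω - g ⊥)) =
      G.expec (fun ω => f ω * g ω) - g ⊥ * G.expec f - f ⊥ * G.expec g + f ⊥ * g ⊥ := by
    rw [← expec_const_mul, ← expec_const_mul, ← expec_const G (f ⊥ * g ⊥), ← expec_sub,
      ← expec_sub, ← expec_add]
    congr 1
    funext ω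
    ring
  rw [e2] at key
  linarith

theorem expec_mul_expec_le_of_antitone {G : PercGraph V E} (hp : G.ProbValid)
    {f g : (E → Bool) → ℝ} (hf : Antitone f) (hg : Antitone g) :
    G.expec f * G.expec g ≤ G.expec fun ω => f ω * g ω := by
  have := expec_mul_expec_le_of_monotone hp (f := fun ω => -1 * f ω) (g := fun ω => -1 * g ω)
    (fun a b h => by linarith [hf h]) (fun a b h => by linarith [hg h])
  rw [expec_const_mul, expec_const_mul] at this
  simpa using this

end Expectation

section Cluster

variable {V E : Type} {G : PercGraph V E}

/-- The edges with an endpoint in `D`. -/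
def touching (G : PercGraph V E) (D : Set V) : Set E :=
  {e | (G.ends e).1 ∈ D ∨ (G.ends e).2 ∈ D}

theorem adj_symm {ω : E → Bool} {x y : V} (h : G.adj ω x y) : G.adj ω y x := by
  obtain ⟨e, he, h⟩ := h
  exact ⟨e, he, h.symm⟩

theorem Conn.symm {ω : E → Bool} {x y : V} (h : G.Conn ω x y) : G.Conn ω y x := by
  induction h with
  | refl => exact Relation.ReflTransGen.refl
  | tail _ h ih => exact Relation.ReflTransGen.head (adj_symm h) ih

theorem conn_comm {ω : E → Bool} {x y : V} : G.Conn ω x y ↔ G.Conn ω y x :=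
  ⟨Conn.symm, Conn.symm⟩

theorem Conn.trans {ω : E → Bool} {x y z : V} (h : G.Conn ω x y) (h' : G.Conn ω y z) :
    G.Conn ω x z :=
  Relation.ReflTransGen.trans h h'

theorem Conn.mono {ω ω' : E → Bool} (hω : ω ≤ ω') {x y : V} (h : G.Conn ω x y) :
    G.Conn ω' x y := by
  induction h with
  | refl => exact Relation.ReflTransGen.refl
  | tail _ h ih =>
    obtain ⟨e, he, h⟩ := h
    exact ih.tail ⟨e, top_le_iff.1 (show (⊤ : Bool) ≤ ω' e from he.symm.le.trans (hω e)), h⟩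

theorem mem_touching_of_ends {D : Set V} {e : E} {x y : V}
    (h : G.ends e = (x, y) ∨ G.ends e = (y, x)) : e ∈ G.touching D ↔ x ∈ D ∨ y ∈ D := by
  rcases h with h | h <;> simp [touching, h, or_comm]

theorem touching_mono {D D' : Set V} (h : D ⊆ D') : G.touching D ⊆ G.touching D' :=
  fun _ he => he.imp (fun h' => h h') (fun h' => h h')

theorem close_mono (J : Set E) : Monotone (close J) := by
  intro ω ω' h e
  by_cases he : e ∈ J
  · simp [close, mix, he]
  · simpa [close, mix, he] using h e

theorem close_anti {J J' : Set E} (h : J ⊆ J') (ω : E → Bool) : close J' ω ≤ close J ω := by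
  intro e
  by_cases he : e ∈ J'
  · simp [close, mix, he]
  · have : e ∉ J := fun h' => he (h h')
    simp [close, mix, he, this]

theorem close_bot (J : Set E) : close J ⊥ = ⊥ := by
  funext e; by_cases he : e ∈ J <;> simp [close, mix, he]

theorem cluster_mono {ω ω' : E → Bool} (h : ω ≤ ω') (S : Set V) :
    G.cluster ω S ⊆ G.cluster ω' S :=
  fun _ ⟨a, ha, hc⟩ => ⟨a, ha, hc.mono h⟩

theorem conn_bot_iff {x y : V} : G.Conn ⊥ x y ↔ x = y := by
  refine ⟨fun h => ?_, fun h => h ▸ Relation.ReflTransGen.refl⟩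
  induction h with
  | refl => rfl
  | tail _ h _ => obtain ⟨e, he, _⟩ := h; simp at he

theorem cluster_bot (S : Set V) : G.cluster ⊥ S = S := by
  ext y
  simp [cluster, conn_bot_iff]

theorem subset_cluster (ω : E → Bool) (S : Set V) : S ⊆ G.cluster ω S :=
  fun s hs => ⟨s, hs, Relation.ReflTransGen.refl⟩

theorem mem_cluster_of_conn {ω : E → Bool} {S : Set V} {x y : V} (hx : x ∈ G.cluster ω S)
    (h : G.Conn ω x y) : y ∈ G.cluster ω S := by
  obtain ⟨a, ha, h'⟩ := hx
  exact ⟨a, ha, h'.trans h⟩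

theorem mem_cluster_singleton {ω : E → Bool} {x y : V} :
    y ∈ G.cluster ω {x} ↔ G.Conn ω x y := by
  simp [cluster]

theorem cluster_congr {η m : E → Bool} {S : Set V}
    (h : ∀ e ∈ G.touching (G.cluster η S), m e = η e) : G.cluster m S = G.cluster η S := by
  ext y
  constructor
  · rintro ⟨a, ha, hc⟩
    induction hc with
    | refl => exact subset_cluster _ _ ha
    | tail _ hxy ih =>
      obtain ⟨e, he, hxy⟩ := hxy
      rw [h e ((mem_touching_of_ends hxy).2 (Or.inl ih))] at he
      exact mem_cluster_of_conn ih (Relation.ReflTransGen.single ⟨e, he, hxy⟩)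
  · rintro ⟨a, ha, hc⟩
    refine ⟨a, ha, ?_⟩
    induction hc with
    | refl => exact Relation.ReflTransGen.refl
    | tail hax hxy ih =>
      obtain ⟨e, he, hxy⟩ := hxy
      refine ih.tail ⟨e, ?_, hxy⟩
      rw [h e ((mem_touching_of_ends hxy).2 (Or.inl ⟨a, ha, hax⟩)), he]

theorem cluster_mix_self (η ω : E → Bool) (S : Set V) :
    G.cluster (mix (G.touching (G.cluster η S)) η ω) S = G.cluster η S :=
  cluster_congr fun e he => by simp [mix, he]

/-- Off an explored cluster only the fresh configuration matters. -/
theorem conn_mix_iff {η ω : E → Bool} {S : Set V} {x y : V} (hx : x ∉ G.cluster η S) :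
    G.Conn (mix (G.touching (G.cluster η S)) η ω) x y ↔
      G.Conn (close (G.touching (G.cluster η S)) ω) x y := by
  constructor
  · intro h
    suffices y ∉ G.cluster η S ∧ G.Conn (close (G.touching (G.cluster η S)) ω) x y from this.2
    induction h with
    | refl => exact ⟨hx, Relation.ReflTransGen.refl⟩
    | @tail u v _ huv ih =>
      obtain ⟨e, he, huv⟩ := huv
      have hv : v ∉ G.cluster η S := by
        intro hv
        have ht : e ∈ G.touching (G.cluster η S) := (mem_touching_of_ends huv).2 (Or.inr hv)
        simp only [mix, ht, if_true] at he
        exact ih.1 (mem_cluster_of_conn hv (Relation.ReflTransGen.single ⟨e, he, huv.symm⟩))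
      have ht : e ∉ G.touching (G.cluster η S) := by
        rw [mem_touching_of_ends huv]; exact not_or.2 ⟨ih.1, hv⟩
      refine ⟨hv, ih.2.tail ⟨e, ?_, huv⟩⟩
      simpa [close, mix, ht] using he
  · refine Conn.mono fun e => ?_
    by_cases he : e ∈ G.touching (G.cluster η S) <;> simp [close, mix, he]

theorem cluster_mix_of_disjoint {η ω : E → Bool} {S T : Set V}
    (hT : ∀ t ∈ T, t ∉ G.cluster η S) :
    G.cluster (mix (G.touching (G.cluster η S)) η ω) T =
      G.cluster (close (G.touching (G.cluster η S)) ω) T := by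
  ext y
  constructor
  · rintro ⟨t, ht, h⟩
    exact ⟨t, ht, (conn_mix_iff (hT t ht)).1 h⟩
  · rintro ⟨t, ht, h⟩
    exact ⟨t, ht, (conn_mix_iff (hT t ht)).2 h⟩

theorem mem_disconn_iff {ω : E → Bool} {S T : Set V} :
    ω ∈ G.disconn S T ↔ ∀ t ∈ T, t ∉ G.cluster ω S := by
  constructor
  · rintro h t ht ⟨s, hs, hc⟩
    exact h s hs t ht hc
  · intro h s hs t ht hc
    exact h t ht ⟨s, hs, hc⟩

theorem disconn_comm (S T : Set V) : G.disconn S T = G.disconn T S := by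
  ext ω
  exact ⟨fun h s hs t ht hc => h t ht s hs hc.symm, fun h s hs t ht hc => h t ht s hs hc.symm⟩

end Cluster

section Association

variable {V E : Type} [Fintype E] [DecidableEq E] {G : PercGraph V E}

/-- Spatial Markov property: explore the cluster of `S` first. -/
theorem expec_explore (S T : Set V) (Φ : (E → Bool) → ℝ) :
    G.expec (fun ω => ind (ω ∈ G.disconn S T) * Φ ω) =
      G.expec fun η => ind (η ∈ G.disconn S T) *
        G.expec fun ω => Φ (mix (G.touching (G.cluster η S)) η ω) := by
  rw [← expec_expec_mix G (fun η => G.touching (G.cluster η S))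
    (fun η ω => by simp only [cluster_mix_self])]
  simp only [mem_disconn_iff, cluster_mix_self, expec_const_mul]

/-- The mean of a function of the cluster of `T` in the graph with `D` deleted. -/
noncomputable def clusterMean (G : PercGraph V E) (T : Set V) (f : Set V → ℝ) (D : Set V) : ℝ :=
  G.expec fun ω => f (G.cluster (close (G.touching D) ω) T)

theorem expec_explore_cluster (S T : Set V) (f : Set V → ℝ) :
    G.expec (fun ω => ind (ω ∈ G.disconn S T) * f (G.cluster ω T)) =
      G.expec fun η => ind (η ∈ G.disconn S T) * G.clusterMean T f (G.cluster η S) := by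
  rw [expec_explore]
  congr 1
  funext η
  by_cases h : η ∈ G.disconn S T
  · have h' := mem_disconn_iff.1 h
    congr 2
    funext ω
    rw [cluster_mix_of_disjoint h']
  · simp [ind_of_not h]

theorem clusterMean_antitone (hp : G.ProbValid) (T : Set V) {f : Set V → ℝ} (hf : Monotone f) :
    Antitone (G.clusterMean T f) := fun _ _ h =>
  expec_mono hp fun ω => hf (cluster_mono (close_anti (touching_mono h) ω) T)

theorem clusterMean_monotone (hp : G.ProbValid) (T : Set V) {f : Set V → ℝ} (hf : Antitone f) :
    Monotone (G.clusterMean T f) := fun _ _ h =>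
  expec_mono hp fun ω => hf (cluster_mono (close_anti (touching_mono h) ω) T)

theorem clusterMean_mul_le_of_monotone (hp : G.ProbValid) (T : Set V) {f g : Set V → ℝ}
    (hf : Monotone f) (hg : Monotone g) (D : Set V) :
    G.clusterMean T f D * G.clusterMean T g D ≤ G.clusterMean T (fun C => f C * g C) D :=
  expec_mul_expec_le_of_monotone hp
    (fun _ _ h => hf (cluster_mono (close_mono _ h) T))
    (fun _ _ h => hg (cluster_mono (close_mono _ h) T))

theorem clusterMean_mul_le_of_antitone (hp : G.ProbValid) (T : Set V) {f g : Set V → ℝ}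
    (hf : Antitone f) (hg : Antitone g) (D : Set V) :
    G.clusterMean T f D * G.clusterMean T g D ≤ G.clusterMean T (fun C => f C * g C) D :=
  expec_mul_expec_le_of_antitone hp
    (fun _ _ h => hf (cluster_mono (close_mono _ h) T))
    (fun _ _ h => hg (cluster_mono (close_mono _ h) T))

theorem clusterMean_mono (hp : G.ProbValid) (T : Set V) {f g : Set V → ℝ}
    (h : ∀ C, f C ≤ g C) (D : Set V) : G.clusterMean T f D ≤ G.clusterMean T g D :=
  expec_mono hp fun _ => h _

theorem clusterMean_const (T : Set V) (c : ℝ) (D : Set V) :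
    G.clusterMean T (fun _ => c) D = c := expec_const G c

/-- The probability that all edges are closed is a Doeblin constant for `clusterMean`. -/
theorem le_clusterMean (hp : G.ProbValid) (T : Set V) {f : Set V → ℝ} {m : ℝ}
    (h : ∀ C, m ≤ f C) (D : Set V) :
    G.weight ⊥ * f T + (1 - G.weight ⊥) * m ≤ G.clusterMean T f D := by
  have := expec_sub_mul_nonneg hp (f := fun ω => f (G.cluster (close (G.touching D) ω) T) - m)
    (fun ω => sub_nonneg.2 (h _)) ⊥
  rw [expec_sub, expec_const, close_bot, cluster_bot] at this
  unfold clusterMean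
  linarith

theorem clusterMean_le (hp : G.ProbValid) (T : Set V) {f : Set V → ℝ} {m : ℝ}
    (h : ∀ C, f C ≤ m) (D : Set V) :
    G.clusterMean T f D ≤ G.weight ⊥ * f T + (1 - G.weight ⊥) * m := by
  have := expec_sub_mul_nonneg hp (f := fun ω => m - f (G.cluster (close (G.touching D) ω) T))
    (fun ω => sub_nonneg.2 (h _)) ⊥
  rw [expec_sub, expec_const, close_bot, cluster_bot] at this
  unfold clusterMean
  linarith

/-- The mean over the event that `S` and `T` are disconnected of a function of the cluster
of `S`. -/
noncomputable def disconnMean (G : PercGraph V E) (S T : Set V) (f : Set V → ℝ) : ℝ :=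
  G.expec fun ω => ind (ω ∈ G.disconn S T) * f (G.cluster ω S)

theorem disconnMean_eq (S T : Set V) (f : Set V → ℝ) :
    G.disconnMean S T f = G.disconnMean T S (G.clusterMean S f) := by
  unfold disconnMean
  rw [disconn_comm S T, expec_explore_cluster T S f]

theorem disconnMean_mono (hp : G.ProbValid) (S T : Set V) {f g : Set V → ℝ}
    (h : ∀ C, f C ≤ g C) : G.disconnMean S T f ≤ G.disconnMean S T g :=
  expec_mono hp fun _ => mul_le_mul_of_nonneg_left (h _) (ind_nonneg _)

/-- Resampling the cluster of `T` and then that of `S` does not increase the covariance. -/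
theorem disconnMean_clusterMean_mul_le (hp : G.ProbValid) (S T : Set V) {f g : Set V → ℝ}
    (hf : Monotone f) (hg : Monotone g) :
    G.disconnMean S T (fun C => G.clusterMean T (G.clusterMean S f) C *
      G.clusterMean T (G.clusterMean S g) C) ≤ G.disconnMean S T fun C => f C * g C := by
  rw [disconnMean_eq S T fun C => f C * g C]
  refine le_trans ?_ (disconnMean_mono hp T S (clusterMean_mul_le_of_monotone hp S hf hg))
  rw [disconnMean_eq T S]
  exact disconnMean_mono hp S T (clusterMean_mul_le_of_antitone hp T
    (clusterMean_antitone hp S hf) (clusterMean_antitone hp S hg))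

theorem disconnMean_resample (S T : Set V) (f : Set V → ℝ) :
    G.disconnMean S T (G.clusterMean T (G.clusterMean S f)) = G.disconnMean S T f := by
  rw [disconnMean_eq S T f, disconnMean_eq T S]

theorem disconnMean_add (S T : Set V) (f g : Set V → ℝ) :
    G.disconnMean S T (fun C => f C + g C) = G.disconnMean S T f + G.disconnMean S T g := by
  simp only [disconnMean, mul_add, expec_add]

theorem disconnMean_const_mul (S T : Set V) (c : ℝ) (f : Set V → ℝ) :
    G.disconnMean S T (fun C => c * f C) = c * G.disconnMean S T f := by
  simp only [disconnMean, ← expec_const_mul]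
  congr 1; funext ω; ring

theorem disconnMean_one_le (hp : G.ProbValid) (S T : Set V) :
    G.disconnMean S T (fun _ => 1) ≤ 1 := by
  refine (expec_mono hp (g := fun _ => 1) fun ω => ?_).trans (expec_const G 1).le
  simpa using ind_le_one _

theorem disconnMean_nonneg (hp : G.ProbValid) (S T : Set V) {f : Set V → ℝ}
    (h : ∀ C, 0 ≤ f C) : 0 ≤ G.disconnMean S T f :=
  expec_nonneg hp fun _ => mul_nonneg (ind_nonneg _) (h _)

theorem weight_bot_nonneg (hp : G.ProbValid) : 0 ≤ G.weight ⊥ := weight_nonneg hp _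

theorem weight_bot_le_one (hp : G.ProbValid) : G.weight ⊥ ≤ 1 := by
  have := expec_sub_mul_nonneg hp (f := fun _ => 1) (fun _ => zero_le_one) ⊥
  rwa [expec_const, one_mul] at this

theorem disconnMean_cov_lower (hp : G.ProbValid) (S T : Set V) (n : ℕ) :
    ∀ (f g : Set V → ℝ), Monotone f → Monotone g → ∀ a b M N : ℝ, 0 ≤ M → 0 ≤ N →
      (∀ C, a ≤ f C ∧ f C ≤ a + M) → (∀ C, b ≤ g C ∧ g C ≤ b + N) →
      G.disconnMean S T f * G.disconnMean S T g - ((1 - G.weight ⊥) ^ 2) ^ n * (M * N) ≤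
        G.disconnMean S T (fun _ => 1) * G.disconnMean S T fun C => f C * g C := by
  have hw0 := weight_bot_nonneg hp
  have hw1 := weight_bot_le_one hp
  set ε := G.weight ⊥ with hε
  induction n with
  | zero =>
    intro f g _ _ a b M N hM hN hf hg
    set Z := G.disconnMean S T (fun _ => 1) with hZ
    have hZ1 : Z ≤ 1 := disconnMean_one_le hp S T
    have hZ0 : 0 ≤ Z := disconnMean_nonneg hp S T fun _ => zero_le_one
    have lin (h : Set V → ℝ) (c : ℝ) : G.disconnMean S T (fun C => h C + c * 1) =
        G.disconnMean S T h + c * Z := by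
      rw [disconnMean_add S T h (fun _ => c * 1), disconnMean_const_mul]
    have hfu : G.disconnMean S T (fun C => f C + (-a) * 1) ≤ M * Z := by
      rw [hZ, ← disconnMean_const_mul]
      exact disconnMean_mono hp S T fun C => by linarith [(hf C).2]
    have hgu : G.disconnMean S T (fun C => g C + (-b) * 1) ≤ N * Z := by
      rw [hZ, ← disconnMean_const_mul]
      exact disconnMean_mono hp S T fun C => by linarith [(hg C).2]
    have hf0 : 0 ≤ G.disconnMean S T (fun C => f C + (-a) * 1) :=
      disconnMean_nonneg hp S T fun C => by linarith [(hf C).1]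
    have hg0 : 0 ≤ G.disconnMean S T (fun C => g C + (-b) * 1) :=
      disconnMean_nonneg hp S T fun C => by linarith [(hg C).1]
    have hfg : 0 ≤ G.disconnMean S T (fun C => (f C + (-a)) * (g C + (-b))) :=
      disconnMean_nonneg hp S T fun C =>
        mul_nonneg (by linarith [(hf C).1]) (by linarith [(hg C).1])
    have e : G.disconnMean S T (fun C => (f C + (-a)) * (g C + (-b))) =
        G.disconnMean S T (fun C => f C * g C) + (-b) * G.disconnMean S T f +
          (-a) * G.disconnMean S T g + a * b * Z := by
      rw [hZ, ← disconnMean_const_mul, ← disconnMean_const_mul, ← disconnMean_const_mul,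
        ← disconnMean_add, ← disconnMean_add, ← disconnMean_add]
      congr 1; funext C; ring
    rw [lin] at hfu hgu hf0 hg0
    rw [e] at hfg
    have h1 := mul_le_mul hfu hgu hg0 (mul_nonneg hM hZ0)
    have h2 := mul_nonneg hZ0 hfg
    have h3 : M * Z * (N * Z) ≤ M * N := by
      have : Z * Z ≤ 1 := mul_le_one₀ hZ1 hZ0 hZ1
      nlinarith [mul_nonneg hM hN]
    simp only [pow_zero, one_mul]
    nlinarith
  | succ n ih =>
    intro f g hf hg a b M N hM hN hfb hgb
    have bound (h : Set V → ℝ) (c K : ℝ) (hb : ∀ C, c ≤ h C ∧ h C ≤ c + K) (C : Set V) :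
        (ε * h S + (1 - ε) * c) ≤ G.clusterMean T (G.clusterMean S h) C ∧
        G.clusterMean T (G.clusterMean S h) C ≤ (ε * h S + (1 - ε) * c) + (1 - ε) * K := by
      constructor
      · rw [← clusterMean_const (G := G) T (ε * h S + (1 - ε) * c) C]
        exact clusterMean_mono hp T (le_clusterMean hp S fun C => (hb C).1) C
      · rw [← clusterMean_const (G := G) T (ε * h S + (1 - ε) * c + (1 - ε) * K) C]
        refine clusterMean_mono hp T (fun D => ?_) C
        have := clusterMean_le hp S (fun C => (hb C).2) D
        linarith
    have := ih (G.clusterMean T (G.clusterMean S f)) (G.clusterMean T (G.clusterMean S g))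
      (clusterMean_monotone hp T (clusterMean_antitone hp S hf))
      (clusterMean_monotone hp T (clusterMean_antitone hp S hg)) _ _ ((1 - ε) * M) ((1 - ε) * N)
      (mul_nonneg (by linarith) hM) (mul_nonneg (by linarith) hN) (bound f a M hfb)
      (bound g b N hgb)
    rw [disconnMean_resample, disconnMean_resample] at this
    have h2 := mul_le_mul_of_nonneg_left (disconnMean_clusterMean_mul_le hp S T hf hg)
      (disconnMean_nonneg hp S T (f := fun _ => (1 : ℝ)) fun _ => zero_le_one)
    have h3 : ((1 - ε) ^ 2) ^ (n + 1) * (M * N) =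
      ((1 - ε) ^ 2) ^ n * ((1 - ε) * M * ((1 - ε) * N)) := by ring
    rw [h3]
    exact this.trans h2

/-- Conditionally on `S` and `T` being disconnected, the cluster of `S` is positively associated
(van den Berg, Häggström and Kahn). -/
theorem disconnMean_mul_le (hp : G.ProbValid) (hw : 0 < G.weight ⊥) (S T : Set V)
    {f g : Set V → ℝ} (hf : Monotone f) (hg : Monotone g) :
    G.disconnMean S T f * G.disconnMean S T g ≤
      G.disconnMean S T (fun _ => 1) * G.disconnMean S T fun C => f C * g C := by
  have hw1 := weight_bot_le_one hp
  have hf' (C : Set V) : f ∅ ≤ f C ∧ f C ≤ f ∅ + (f Set.univ - f ∅) :=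
    ⟨hf (Set.empty_subset C), by linarith [hf (Set.subset_univ C)]⟩
  have hg' (C : Set V) : g ∅ ≤ g C ∧ g C ≤ g ∅ + (g Set.univ - g ∅) :=
    ⟨hg (Set.empty_subset C), by linarith [hg (Set.subset_univ C)]⟩
  have hlim : Filter.Tendsto (fun n : ℕ => G.disconnMean S T f * G.disconnMean S T g -
      ((1 - G.weight ⊥) ^ 2) ^ n * ((f Set.univ - f ∅) * (g Set.univ - g ∅))) Filter.atTop
      (nhds (G.disconnMean S T f * G.disconnMean S T g -
        0 * ((f Set.univ - f ∅) * (g Set.univ - g ∅)))) := by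
    refine tendsto_const_nhds.sub (Filter.Tendsto.mul_const _ ?_)
    exact tendsto_pow_atTop_nhds_zero_of_lt_one (by positivity) (by nlinarith)
  rw [zero_mul, sub_zero] at hlim
  refine le_of_tendsto' hlim fun n => disconnMean_cov_lower hp S T n f g hf hg _ _ _ _ ?_ ?_ hf' hg'
  · linarith [hf (Set.empty_subset Set.univ)]
  · linarith [hg (Set.empty_subset Set.univ)]

theorem disconnMean_mul_le_of_antitone (hp : G.ProbValid) (hw : 0 < G.weight ⊥) (S T : Set V)
    {f g : Set V → ℝ} (hf : Antitone f) (hg : Antitone g) :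
    G.disconnMean S T f * G.disconnMean S T g ≤
      G.disconnMean S T (fun _ => 1) * G.disconnMean S T fun C => f C * g C := by
  have := disconnMean_mul_le hp hw S T (f := fun C => -1 * f C) (g := fun C => -1 * g C)
    (fun _ _ h => by linarith [hf h]) (fun _ _ h => by linarith [hg h])
  rw [disconnMean_const_mul, disconnMean_const_mul] at this
  simpa using this

theorem disconnMean_mul_ge (hp : G.ProbValid) (hw : 0 < G.weight ⊥) (S T : Set V)
    {f g : Set V → ℝ} (hf : Monotone f) (hg : Antitone g) :
    G.disconnMean S T (fun _ => 1) * G.disconnMean S T (fun C => f C * g C) ≤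
      G.disconnMean S T f * G.disconnMean S T g := by
  have := disconnMean_mul_le hp hw S T (g := fun C => -1 * g C) hf
    (fun _ _ h => by linarith [hg h])
  have e : (fun C => f C * (-1 * g C)) = fun C => -1 * (f C * g C) := by funext C; ring
  rw [e, disconnMean_const_mul, disconnMean_const_mul] at this
  linarith

end Association

section FourPoints

variable {V E : Type} [Fintype E] [DecidableEq E] {G : PercGraph V E}

/-- Among `i, j, k`, the vertex `o` is connected to `i` only, and `j`, `k` are not connected. -/
def Sole (G : PercGraph V E) (o i j k : V) (ω : E → Bool) : Prop :=
  G.Conn ω o i ∧ ¬ G.Conn ω o j ∧ ¬ G.Conn ω o k ∧ ¬ G.Conn ω j k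

/-- Among `i, j, k`, the vertex `o` is connected to `i` only, and `j`, `k` are connected. -/
def Paired (G : PercGraph V E) (o i j k : V) (ω : E → Bool) : Prop :=
  G.Conn ω o i ∧ ¬ G.Conn ω o j ∧ ¬ G.Conn ω o k ∧ G.Conn ω j k

/-- Among `i, j, k`, the vertex `o` is connected to `j` and `k` but not to `i`. -/
def Missing (G : PercGraph V E) (o i j k : V) (ω : E → Bool) : Prop :=
  ¬ G.Conn ω o i ∧ G.Conn ω o j ∧ G.Conn ω o k

theorem mem_disconn_pair {ω : E → Bool} {i j k : V} :
    ω ∈ G.disconn {i} {j, k} ↔ ¬ G.Conn ω i j ∧ ¬ G.Conn ω i k := by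
  simp [disconn]

/-- The probability that `j` and `k` are connected after deleting `D`. -/
noncomputable def connOff (G : PercGraph V E) (j k : V) (D : Set V) : ℝ :=
  G.expec fun ω => ind (G.Conn (close (G.touching D) ω) j k)

/-- The probability that `o` is connected to `{j, k}` after deleting `D ∌ o`. -/
noncomputable def connPairOff (G : PercGraph V E) (o j k : V) (D : Set V) : ℝ :=
  ind (o ∉ D) * G.expec fun ω =>
    ind (G.Conn (close (G.touching D) ω) o j ∨ G.Conn (close (G.touching D) ω) o k)

theorem connOff_antitone (hp : G.ProbValid) (j k : V) : Antitone (G.connOff j k) := fun _ _ h =>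
  expec_mono hp fun ω => ind_mono (Conn.mono (close_anti (touching_mono h) ω))

theorem connPairOff_antitone (hp : G.ProbValid) (o j k : V) :
    Antitone (G.connPairOff o j k) := fun _ _ h =>
  mul_le_mul (ind_mono fun h' ho => h' (h ho))
    (expec_mono hp fun ω => ind_mono (Or.imp (Conn.mono (close_anti (touching_mono h) ω))
      (Conn.mono (close_anti (touching_mono h) ω))))
    (expec_nonneg hp fun _ => ind_nonneg _) (ind_nonneg _)

theorem connOff_le (hp : G.ProbValid) {j k : V} (hjk : j ≠ k) (D : Set V) :
    G.connOff j k D ≤ 1 - G.weight ⊥ := by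
  have := expec_sub_mul_nonneg hp (f := fun ω => 1 - ind (G.Conn (close (G.touching D) ω) j k))
    (fun ω => sub_nonneg.2 (ind_le_one _)) ⊥
  rw [expec_sub, expec_const, close_bot, conn_bot_iff, ind_of_not hjk] at this
  unfold connOff
  linarith

theorem expec_paired (o i j k : V) :
    G.expec (fun ω => ind (G.Paired o i j k ω)) =
      G.disconnMean {i} {j, k} fun C => ind (o ∈ C) * G.connOff j k C := by
  have h1 : (fun ω => ind (G.Paired o i j k ω)) = fun ω => ind (ω ∈ G.disconn {i} {j, k}) *
      (ind (o ∈ G.cluster ω {i}) * ind (G.Conn ω j k)) := by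
    funext ω
    rw [← ind_and, ← ind_and, mem_disconn_pair, mem_cluster_singleton]
    congr 1
    refine propext ⟨fun ⟨h1, h2, h3, h4⟩ => ⟨⟨fun h => h2 (h1.trans h), fun h => h3 (h1.trans h)⟩,
      h1.symm, h4⟩, fun ⟨⟨h1, h2⟩, h3, h4⟩ => ⟨h3.symm, fun h => h1 (h3.trans h),
      fun h => h2 (h3.trans h), h4⟩⟩
  rw [h1, expec_explore]
  refine congrArg _ (funext fun η => ?_)
  by_cases h : η ∈ G.disconn {i} {j, k}
  · have hj : j ∉ G.cluster η {i} := mem_disconn_iff.1 h j (by simp)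
    simp only [cluster_mix_self, conn_mix_iff hj, expec_const_mul]
    rfl
  · simp [ind_of_not h]

theorem expec_sole_add_paired (o i j k : V) :
    G.expec (fun ω => ind (G.Sole o i j k ω)) + G.expec (fun ω => ind (G.Paired o i j k ω)) =
      G.disconnMean {i} {j, k} fun C => ind (o ∈ C) := by
  rw [← expec_add]
  refine congrArg _ (funext fun ω => ?_)
  rw [← ind_and, mem_disconn_pair, mem_cluster_singleton]
  by_cases hi : G.Conn ω o i
  · have e (v : V) : G.Conn ω i v ↔ G.Conn ω o v := ⟨hi.trans, hi.symm.trans⟩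
    have ho : G.Conn ω o o := Relation.ReflTransGen.refl
    by_cases h1 : G.Conn ω o j <;> by_cases h2 : G.Conn ω o k <;> by_cases h3 : G.Conn ω j k <;>
      simp [ind, Sole, Paired, e, hi, h1, h2, h3, ho]
  · have hi' : ¬ G.Conn ω i o := fun h => hi h.symm
    simp [ind, Sole, Paired, hi, hi']

theorem disconnMean_of_not_mem (o i j k : V) (P : (V → Prop) → Prop) :
    G.expec (fun ω => ind (ω ∈ G.disconn {i} {j, k}) *
        (ind (o ∉ G.cluster ω {i}) * ind (P (G.Conn ω o)))) =
      G.disconnMean {i} {j, k} fun C => ind (o ∉ C) *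
        G.expec fun ω => ind (P (G.Conn (close (G.touching C) ω) o)) := by
  rw [expec_explore]
  refine congrArg _ (funext fun η => ?_)
  by_cases h : o ∉ G.cluster η {i}
  · have e (ω : E → Bool) : G.Conn (mix (G.touching (G.cluster η {i})) η ω) o =
        G.Conn (close (G.touching (G.cluster η {i})) ω) o :=
      funext fun y => propext (conn_mix_iff h)
    simp only [cluster_mix_self, e, expec_const_mul]
  · simp only [cluster_mix_self, ind_of_not h, zero_mul, expec_const]

theorem expec_missing_add_sole (o i j k : V) :
    G.expec (fun ω => ind (G.Missing o i j k ω)) + (G.expec (fun ω => ind (G.Sole o j i k ω)) +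
      G.expec (fun ω => ind (G.Sole o k i j ω))) =
      G.disconnMean {i} {j, k} (G.connPairOff o j k) := by
  have := disconnMean_of_not_mem (G := G) o i j k fun Q => Q j ∨ Q k
  unfold connPairOff
  rw [← this, ← expec_add, ← expec_add]
  refine congrArg _ (funext fun ω => ?_)
  rw [← ind_and, ← ind_and, mem_disconn_pair, mem_cluster_singleton]
  by_cases hi : G.Conn ω o i
  · simp [ind, Sole, Missing, hi, hi.symm]
  · have hi' : ¬ G.Conn ω i o := fun h => hi h.symm
    by_cases hj : G.Conn ω o j
    · have hij : ¬ G.Conn ω i j := fun h => hi' (h.trans hj.symm)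
      by_cases hk : G.Conn ω o k
      · have hik : ¬ G.Conn ω i k := fun h => hi' (h.trans hk.symm)
        simp [ind, Sole, Missing, hi, hi', hj, hk, hij, hik]
      · by_cases hik : G.Conn ω i k <;> simp [ind, Sole, Missing, hi, hi', hj, hk, hij, hik]
    · by_cases hk : G.Conn ω o k
      · have hik : ¬ G.Conn ω i k := fun h => hi' (h.trans hk.symm)
        by_cases hij : G.Conn ω i j <;> simp [ind, Sole, Missing, hi, hi', hj, hk, hij, hik]
      · simp [ind, Sole, Missing, hj, hk]

theorem disconnMean_le_expec_missing (hp : G.ProbValid) (o i j k : V) :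
    G.disconnMean {i} {j, k} (fun C => G.connPairOff o j k C * G.connOff j k C) ≤
      G.expec fun ω => ind (G.Missing o i j k ω) := by
  have h1 : (fun ω => ind (G.Missing o i j k ω)) = fun ω => ind (ω ∈ G.disconn {i} {j, k}) *
      (ind (o ∉ G.cluster ω {i}) * ind (G.Conn ω o j ∧ G.Conn ω o k)) := by
    funext ω
    rw [← ind_and, ← ind_and, mem_disconn_pair, mem_cluster_singleton]
    congr 1
    refine propext ⟨fun ⟨h1, h2, h3⟩ => ⟨⟨fun h => h1 (h2.trans h.symm),
      fun h => h1 (h3.trans h.symm)⟩, fun h => h1 h.symm, h2, h3⟩,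
      fun ⟨_, h3, h4⟩ => ⟨fun h => h3 h.symm, h4⟩⟩
  rw [h1, disconnMean_of_not_mem o i j k fun Q => Q j ∧ Q k]
  refine disconnMean_mono hp _ _ fun C => ?_
  unfold connPairOff connOff
  rw [mul_assoc]
  refine mul_le_mul_of_nonneg_left ?_ (ind_nonneg _)
  refine (expec_mul_expec_le_of_monotone hp
    (fun _ _ h => ind_mono (Or.imp (Conn.mono (close_mono _ h)) (Conn.mono (close_mono _ h))))
    (fun _ _ h => ind_mono (Conn.mono (close_mono _ h)))).trans (expec_mono hp fun ω => ?_)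
  rw [← ind_and]
  refine ind_mono ?_
  rintro ⟨h | h, h'⟩
  · exact ⟨h, h.trans h'⟩
  · exact ⟨h.trans h'.symm, h⟩

theorem expec_paired_mul_le (hp : G.ProbValid) (hw : 0 < G.weight ⊥) {i j k : V} (o : V)
    (hij : i ≠ j) (hik : i ≠ k) :
    G.expec (fun ω => ind (G.Paired o i j k ω)) *
      (G.expec (fun ω => ind (G.Sole o j i k ω)) + G.expec (fun ω => ind (G.Sole o k i j ω))) ≤
    G.expec (fun ω => ind (G.Sole o i j k ω)) * G.expec (fun ω => ind (G.Missing o i j k ω)) := by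
  have hF : Monotone fun C : Set V => ind (o ∈ C) := fun _ _ h => ind_mono fun ho => h ho
  have a1 := disconnMean_mul_ge hp hw {i} {j, k} hF (connOff_antitone hp j k)
  have a2 := disconnMean_mul_le_of_antitone hp hw {i} {j, k} (connPairOff_antitone hp o j k)
    (connOff_antitone hp j k)
  have a3 := disconnMean_le_expec_missing hp o i j k
  rw [← expec_paired, ← expec_sole_add_paired] at a1
  rw [← expec_missing_add_sole] at a2
  have hZ : 0 < G.disconnMean {i} {j, k} (fun _ => 1) := by
    have h := expec_sub_mul_nonneg hp (f := fun ω => ind (ω ∈ G.disconn {i} {j, k}) * 1)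
      (fun ω => by simpa using ind_nonneg _) ⊥
    rw [ind_of (mem_disconn_pair.2 ⟨by rwa [conn_bot_iff], by rwa [conn_bot_iff]⟩), one_mul,
      one_mul] at h
    exact hw.trans_le h
  have nn (P : (E → Bool) → Prop) : 0 ≤ G.expec fun ω => ind (P ω) :=
    expec_nonneg hp fun _ => ind_nonneg _
  have n1 := nn (G.Paired o i j k)
  have n2 := nn (G.Sole o i j k)
  have n3 := nn (G.Missing o i j k)
  have n4 := nn (G.Sole o j i k)
  have n5 := nn (G.Sole o k i j)
  set Z := G.disconnMean {i} {j, k} (fun _ => 1)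
  set y := G.expec fun ω => ind (G.Paired o i j k ω)
  set x := G.expec fun ω => ind (G.Sole o i j k ω)
  set z := G.expec fun ω => ind (G.Missing o i j k ω)
  set u := G.expec (fun ω => ind (G.Sole o j i k ω)) + G.expec fun ω => ind (G.Sole o k i j ω)
  have hu : 0 ≤ u := add_nonneg n4 n5
  have b1 := mul_le_mul_of_nonneg_right a1 (add_nonneg n3 hu)
  have b2 := mul_le_mul_of_nonneg_left (a2.trans (mul_le_mul_of_nonneg_left a3 hZ.le))
    (add_nonneg n2 n1)
  have b3 : Z * (y * (z + u)) ≤ Z * ((x + y) * z) := by nlinarith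
  have b4 := le_of_mul_le_mul_left b3 hZ
  linarith

theorem mul_expec_paired_le (hp : G.ProbValid) {i j k : V} (o : V) (hjk : j ≠ k) :
    G.weight ⊥ * G.expec (fun ω => ind (G.Paired o i j k ω)) ≤
      G.expec (fun ω => ind (G.Sole o i j k ω)) := by
  have h1 : G.expec (fun ω => ind (G.Paired o i j k ω)) ≤
      (1 - G.weight ⊥) * G.disconnMean {i} {j, k} fun C => ind (o ∈ C) := by
    rw [expec_paired, ← disconnMean_const_mul]
    refine disconnMean_mono hp _ _ fun C => ?_
    rw [mul_comm]
    exact mul_le_mul_of_nonneg_right (connOff_le hp hjk C) (ind_nonneg _)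
  rw [← expec_sole_add_paired] at h1
  have n1 : 0 ≤ G.expec fun ω => ind (G.Sole o i j k ω) := expec_nonneg hp fun _ => ind_nonneg _
  have := weight_bot_nonneg hp
  nlinarith

end FourPoints

section Algebra

/-- The value of `P(0 ↔ b, 0 ↔ A) - P(0 ↔ A, a ↔ b)` in terms of the probabilities of the
partitions induced on the two sides of a three-point separating set. -/
def gap (x₂ x₃ y₂ y₃ z₁ β₁ β₂ β₃ γ₁ γ₂ γ₃ δ₁ δ₂ δ₃ : ℝ) : ℝ :=
  x₂ * ((β₂ + γ₂ - δ₂) - (β₁ + γ₁ - δ₁)) + x₃ * ((β₃ + γ₃ - δ₃) - (β₁ + γ₁ - δ₁)) +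
    y₂ * (β₂ + γ₂ - δ₂ - β₁ - β₃) + y₃ * (β₃ + γ₃ - δ₃ - β₁ - β₂) -
    z₁ * (β₁ + γ₁ - δ₁ - β₂ - β₃)

theorem gap_nonneg_of_dominant {x₁ x₂ x₃ y₁ y₂ y₃ z₂ z₃ β₁ β₂ β₃ γ₁ γ₂ γ₃ δ₁ δ₂ δ₃ ε : ℝ}
    (hε : 0 < ε) (hx₁ : 0 ≤ x₁) (hx₂ : 0 ≤ x₂) (hx₃ : 0 ≤ x₃) (hy₁ : 0 ≤ y₁) (hy₂ : 0 ≤ y₂)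
    (hy₃ : 0 ≤ y₃) (hz₂ : 0 ≤ z₂)
    (hβ₁ : 0 ≤ β₁) (hβ₂ : 0 ≤ β₂) (hβ₃ : 0 ≤ β₃)
    (hδ₁ : 0 ≤ δ₁) (hδ₂ : 0 ≤ δ₂) (hδ₃ : 0 ≤ δ₃)
    (hxy₃ : ε * y₃ ≤ x₃) (hβγ₂ : ε * γ₂ ≤ β₂) (hβγ₃ : ε * γ₃ ≤ β₃)
    (hk₂ : y₂ * (x₁ + x₃) ≤ x₂ * z₂) (hk₃ : y₃ * (x₁ + x₂) ≤ x₃ * z₃)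
    (hl₁ : γ₁ * (β₂ + β₃) ≤ β₁ * δ₁) (hl₂ : γ₂ * (β₁ + β₃) ≤ β₂ * δ₂)
    (hl₃ : γ₃ * (β₁ + β₂) ≤ β₃ * δ₃) (hs : 0 < β₁ + γ₁ - δ₁ - β₂ - β₃) :
    0 ≤ gap x₁ x₃ y₁ y₃ z₂ β₂ β₁ β₃ γ₂ γ₁ γ₃ δ₂ δ₁ δ₃ ∨
      0 ≤ gap x₁ x₂ y₁ y₂ z₃ β₃ β₁ β₂ γ₃ γ₁ γ₂ δ₃ δ₁ δ₂ := by
  have hb : β₂ + β₃ ≤ β₁ := by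
    by_contra! h
    have hb0 : 0 < β₂ + β₃ := lt_of_le_of_lt hβ₁ h
    nlinarith [mul_pos hb0 hs, mul_pos (sub_pos.2 h) hb0, mul_nonneg (sub_pos.2 h).le hδ₁]
  have hγδ₂ : γ₂ ≤ δ₂ := by
    rcases (add_nonneg hβ₁ hβ₃).eq_or_lt with h | h
    · have : β₂ = 0 := by linarith
      have : ε * γ₂ ≤ 0 := by linarith
      have : γ₂ ≤ 0 := nonpos_of_mul_nonpos_right this hε
      linarith
    · refine le_of_mul_le_mul_right (hl₂.trans ?_) h
      rw [mul_comm]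
      exact mul_le_mul_of_nonneg_left (by linarith) hδ₂
  have hγδ₃ : γ₃ ≤ δ₃ := by
    rcases (add_nonneg hβ₁ hβ₂).eq_or_lt with h | h
    · have : β₃ = 0 := by linarith
      have : ε * γ₃ ≤ 0 := by linarith
      have : γ₃ ≤ 0 := nonpos_of_mul_nonpos_right this hε
      linarith
    · refine le_of_mul_le_mul_right (hl₃.trans ?_) h
      rw [mul_comm]
      exact mul_le_mul_of_nonneg_left (by linarith) hδ₃
  have hs₂ : 0 ≤ -(β₂ + γ₂ - δ₂ - β₁ - β₃) := by linarith
  have hs₃ : 0 ≤ -(β₃ + γ₃ - δ₃ - β₁ - β₂) := by linarith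
  have hw₂ : 0 ≤ (β₁ + γ₁ - δ₁) - (β₂ + γ₂ - δ₂) := by linarith
  have hw₃ : 0 ≤ (β₁ + γ₁ - δ₁) - (β₃ + γ₃ - δ₃) := by linarith
  have ht₂ : 0 ≤ x₂ * z₂ - y₂ * x₃ := by nlinarith [mul_nonneg hy₂ hx₁]
  have ht₃ : 0 ≤ x₃ * z₃ - y₃ * x₂ := by nlinarith [mul_nonneg hy₃ hx₁]
  rcases (add_nonneg hx₂ hx₃).eq_or_lt with h | h
  · left
    have e₃ : x₃ = 0 := by linarith
    have : ε * y₃ ≤ 0 := by linarith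
    have e₃' : y₃ = 0 := le_antisymm (nonpos_of_mul_nonpos_right this hε) hy₃
    unfold gap
    rw [e₃, e₃']
    nlinarith [mul_nonneg hx₁ hw₂, mul_nonneg hy₁ hs.le, mul_nonneg hz₂ hs₂]
  · by_contra! hneg
    have hsum : x₂ * gap x₁ x₃ y₁ y₃ z₂ β₂ β₁ β₃ γ₂ γ₁ γ₃ δ₂ δ₁ δ₃ +
        x₃ * gap x₁ x₂ y₁ y₂ z₃ β₃ β₁ β₂ γ₃ γ₁ γ₂ δ₃ δ₁ δ₂ =
        x₁ * (x₂ * ((β₁ + γ₁ - δ₁) - (β₂ + γ₂ - δ₂))) +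
        x₁ * (x₃ * ((β₁ + γ₁ - δ₁) - (β₃ + γ₃ - δ₃))) +
        (x₂ + x₃) * (y₁ * (β₁ + γ₁ - δ₁ - β₂ - β₃)) +
        (x₂ * z₂ - y₂ * x₃) * -(β₂ + γ₂ - δ₂ - β₁ - β₃) +
        (x₃ * z₃ - y₃ * x₂) * -(β₃ + γ₃ - δ₃ - β₁ - β₂) := by
      unfold gap; ring
    have hpos : 0 ≤ x₂ * gap x₁ x₃ y₁ y₃ z₂ β₂ β₁ β₃ γ₂ γ₁ γ₃ δ₂ δ₁ δ₃ +
        x₃ * gap x₁ x₂ y₁ y₂ z₃ β₃ β₁ β₂ γ₃ γ₁ γ₂ δ₃ δ₁ δ₂ := by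
      rw [hsum]
      have := hs.le
      positivity
    rcases hx₂.eq_or_lt with h₂ | h₂
    · have h₃ : 0 < x₃ := by linarith
      rw [← h₂, zero_mul, zero_add] at hpos
      exact absurd hpos (not_le.2 (h₂ ▸ mul_neg_of_pos_of_neg h₃ hneg.2))
    · have a := mul_neg_of_pos_of_neg h₂ hneg.1
      have b := mul_nonpos_of_nonneg_of_nonpos hx₃ hneg.2.le
      linarith

theorem exists_gap_nonneg {x₁ x₂ x₃ y₁ y₂ y₃ z₁ z₂ z₃ β₁ β₂ β₃ γ₁ γ₂ γ₃ δ₁ δ₂ δ₃ ε : ℝ}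
    (hε : 0 < ε) (hx₁ : 0 ≤ x₁) (hx₂ : 0 ≤ x₂) (hx₃ : 0 ≤ x₃) (hy₁ : 0 ≤ y₁) (hy₂ : 0 ≤ y₂)
    (hy₃ : 0 ≤ y₃) (hz₁ : 0 ≤ z₁) (hz₂ : 0 ≤ z₂)
    (hβ₁ : 0 ≤ β₁) (hβ₂ : 0 ≤ β₂) (hβ₃ : 0 ≤ β₃)
    (hδ₁ : 0 ≤ δ₁) (hδ₂ : 0 ≤ δ₂) (hδ₃ : 0 ≤ δ₃)
    (hxy₂ : ε * y₂ ≤ x₂) (hxy₃ : ε * y₃ ≤ x₃)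
    (hβγ₁ : ε * γ₁ ≤ β₁) (hβγ₂ : ε * γ₂ ≤ β₂) (hβγ₃ : ε * γ₃ ≤ β₃)
    (hk₁ : y₁ * (x₂ + x₃) ≤ x₁ * z₁) (hk₂ : y₂ * (x₁ + x₃) ≤ x₂ * z₂)
    (hk₃ : y₃ * (x₁ + x₂) ≤ x₃ * z₃)
    (hl₁ : γ₁ * (β₂ + β₃) ≤ β₁ * δ₁) (hl₂ : γ₂ * (β₁ + β₃) ≤ β₂ * δ₂)
    (hl₃ : γ₃ * (β₁ + β₂) ≤ β₃ * δ₃) :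
    0 ≤ gap x₂ x₃ y₂ y₃ z₁ β₁ β₂ β₃ γ₁ γ₂ γ₃ δ₁ δ₂ δ₃ ∨
      0 ≤ gap x₁ x₃ y₁ y₃ z₂ β₂ β₁ β₃ γ₂ γ₁ γ₃ δ₂ δ₁ δ₃ ∨
      0 ≤ gap x₁ x₂ y₁ y₂ z₃ β₃ β₁ β₂ γ₃ γ₁ γ₂ δ₃ δ₁ δ₂ := by
  by_cases hs₁ : 0 < β₁ + γ₁ - δ₁ - β₂ - β₃
  · exact Or.inr (gap_nonneg_of_dominant hε hx₁ hx₂ hx₃ hy₁ hy₂ hy₃ hz₂ hβ₁ hβ₂ hβ₃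
      hδ₁ hδ₂ hδ₃ hxy₃ hβγ₂ hβγ₃ hk₂ hk₃ hl₁ hl₂ hl₃ hs₁)
  by_cases hs₂ : 0 < β₂ + γ₂ - δ₂ - β₁ - β₃
  · have := gap_nonneg_of_dominant hε hx₂ hx₁ hx₃ hy₂ hy₁ hy₃ hz₁ hβ₂ hβ₁ hβ₃
      hδ₂ hδ₁ hδ₃ hxy₃ hβγ₁ hβγ₃ hk₁ (by rwa [add_comm]) hl₂ hl₁ (by rwa [add_comm]) hs₂
    rcases this with h | h
    · exact Or.inl h
    · refine Or.inr (Or.inr (h.trans_eq ?_))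
      unfold gap; ring
  by_cases hs₃ : 0 < β₃ + γ₃ - δ₃ - β₁ - β₂
  · have := gap_nonneg_of_dominant hε hx₃ hx₁ hx₂ hy₃ hy₁ hy₂ hz₁ hβ₃ hβ₁ hβ₂
      hδ₃ hδ₁ hδ₂ hxy₂ hβγ₁ hβγ₂ (by rwa [add_comm]) (by rwa [add_comm]) hl₃
      (by rwa [add_comm]) (by rwa [add_comm]) hs₃
    rcases this with h | h
    · refine Or.inl (h.trans_eq ?_)
      unfold gap; ring
    · refine Or.inr (Or.inl (h.trans_eq ?_))
      unfold gap; ring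
  rw [not_lt, ← neg_nonneg] at hs₁ hs₂ hs₃
  rcases (add_nonneg (add_nonneg hx₁ hx₂) hx₃).eq_or_lt with h | h
  · left
    have e₂ : x₂ = 0 := by linarith
    have e₃ : x₃ = 0 := by linarith
    have e₂' : y₂ = 0 :=
      le_antisymm (nonpos_of_mul_nonpos_right (hxy₂.trans e₂.le) hε) hy₂
    have e₃' : y₃ = 0 :=
      le_antisymm (nonpos_of_mul_nonpos_right (hxy₃.trans e₃.le) hε) hy₃
    unfold gap
    rw [e₂, e₃, e₂', e₃']
    nlinarith [mul_nonneg hz₁ hs₁]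
  · by_contra! hneg
    have hsum : x₁ * gap x₂ x₃ y₂ y₃ z₁ β₁ β₂ β₃ γ₁ γ₂ γ₃ δ₁ δ₂ δ₃ +
        x₂ * gap x₁ x₃ y₁ y₃ z₂ β₂ β₁ β₃ γ₂ γ₁ γ₃ δ₂ δ₁ δ₃ +
        x₃ * gap x₁ x₂ y₁ y₂ z₃ β₃ β₁ β₂ γ₃ γ₁ γ₂ δ₃ δ₁ δ₂ =
        (x₁ * z₁ - y₁ * (x₂ + x₃)) * -(β₁ + γ₁ - δ₁ - β₂ - β₃) +
        (x₂ * z₂ - y₂ * (x₁ + x₃)) * -(β₂ + γ₂ - δ₂ - β₁ - β₃) +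
        (x₃ * z₃ - y₃ * (x₁ + x₂)) * -(β₃ + γ₃ - δ₃ - β₁ - β₂) := by
      unfold gap; ring
    have hpos := add_nonneg (add_nonneg (mul_nonneg (sub_nonneg.2 hk₁) hs₁)
      (mul_nonneg (sub_nonneg.2 hk₂) hs₂)) (mul_nonneg (sub_nonneg.2 hk₃) hs₃)
    rw [← hsum] at hpos
    obtain ⟨h₁, h₂, h₃⟩ := hneg
    have a₁ := mul_nonpos_of_nonneg_of_nonpos hx₁ h₁.le
    have a₂ := mul_nonpos_of_nonneg_of_nonpos hx₂ h₂.le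
    have a₃ := mul_nonpos_of_nonneg_of_nonpos hx₃ h₃.le
    have b₁ : x₁ = 0 := (mul_eq_zero.1 (by linarith :
      x₁ * gap x₂ x₃ y₂ y₃ z₁ β₁ β₂ β₃ γ₁ γ₂ γ₃ δ₁ δ₂ δ₃ = 0)).resolve_right h₁.ne
    have b₂ : x₂ = 0 := (mul_eq_zero.1 (by linarith :
      x₂ * gap x₁ x₃ y₁ y₃ z₂ β₂ β₁ β₃ γ₂ γ₁ γ₃ δ₂ δ₁ δ₃ = 0)).resolve_right h₂.ne
    have b₃ : x₃ = 0 := (mul_eq_zero.1 (by linarith :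
      x₃ * gap x₁ x₂ y₁ y₂ z₃ β₃ β₁ β₂ γ₃ γ₁ γ₂ δ₃ δ₁ δ₂ = 0)).resolve_right h₃.ne
    linarith

end Algebra

section Separation

variable {V E : Type} {G : PercGraph V E}

/-- The graph `G` with the edges off `M` turned into loops. -/
noncomputable def restrict (G : PercGraph V E) (M : Set E) : PercGraph V E :=
  open Classical in
  ⟨fun e => if e ∈ M then G.ends e else ((G.ends e).1, (G.ends e).1), G.p⟩

theorem conn_restrict_induction {M : Set E} {ω : E → Bool} {x y : V} {P : V → Prop}
    (h : (G.restrict M).Conn ω x y) (hx : P x)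
    (hP : ∀ e ∈ M, ω e = true → ∀ u v, G.ends e = (u, v) ∨ G.ends e = (v, u) → P u → P v) :
    P y := by
  induction h with
  | refl => exact hx
  | @tail u v _ huv ih =>
    obtain ⟨e, he, huv⟩ := huv
    by_cases heM : e ∈ M
    · exact hP e heM he u v (by simpa [restrict, heM] using huv) ih
    · simp only [restrict, heM, if_false, Prod.mk.injEq] at huv
      have : u = v := by rcases huv with ⟨h, h'⟩ | ⟨h, h'⟩ <;> rw [← h, ← h']
      exact this ▸ ih

theorem Conn.restrict_tail {M : Set E} {ω : E → Bool} {x u v : V} {e : E}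
    (h : (G.restrict M).Conn ω x u) (heM : e ∈ M) (he : ω e = true)
    (huv : G.ends e = (u, v) ∨ G.ends e = (v, u)) : (G.restrict M).Conn ω x v :=
  h.tail ⟨e, he, by simpa [restrict, heM] using huv⟩

theorem Conn.of_restrict {M : Set E} {ω : E → Bool} {x y : V}
    (h : (G.restrict M).Conn ω x y) : G.Conn ω x y :=
  conn_restrict_induction h Relation.ReflTransGen.refl
    fun e _ he _ _ huv h => h.tail ⟨e, he, huv⟩

theorem conn_restrict_congr {M : Set E} {η ω : E → Bool} (h : ∀ e ∈ M, η e = ω e) :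
    (G.restrict M).Conn η = (G.restrict M).Conn ω := by
  have key {η ω : E → Bool} (h : ∀ e ∈ M, η e = ω e) (x y : V)
      (hc : (G.restrict M).Conn η x y) : (G.restrict M).Conn ω x y :=
    conn_restrict_induction hc Relation.ReflTransGen.refl
      fun e heM he _ _ huv hc => hc.restrict_tail heM (h e heM ▸ he) huv
  funext x y
  exact propext ⟨key h x y, key (fun e he => (h e he).symm) x y⟩

theorem conn_restrict_mix (M : Set E) (η ω : E → Bool) :
    (G.restrict M).Conn (mix M η ω) = (G.restrict M).Conn η :=
  conn_restrict_congr fun e he => by simp [mix, he]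

theorem conn_restrict_compl_mix (M : Set E) (η ω : E → Bool) :
    (G.restrict Mᶜ).Conn (mix M η ω) = (G.restrict Mᶜ).Conn ω :=
  conn_restrict_congr fun e he => by simp [mix, show e ∉ M from he]

/-- Every edge leaving `R` ends in `A`. -/
def Encloses (G : PercGraph V E) (A R : Set V) : Prop :=
  ∀ e u v, G.ends e = (u, v) ∨ G.ends e = (v, u) → u ∈ R → v ∈ R ∪ A

/-- The part of `G` spanned by the edges touching `R`. -/
noncomputable def inner (G : PercGraph V E) (R : Set V) : PercGraph V E :=
  G.restrict (G.touching R)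

/-- The part of `G` spanned by the edges not touching `R`. -/
noncomputable def outer (G : PercGraph V E) (R : Set V) : PercGraph V E :=
  G.restrict (G.touching R)ᶜ

variable {A R : Set V} {ω : E → Bool}

theorem Encloses.mem_of_conn_inner (hR : G.Encloses A R) {x y : V} (hx : x ∈ R ∪ A)
    (h : (G.inner R).Conn ω x y) : y ∈ R ∪ A := by
  refine conn_restrict_induction h hx fun e he _ u v huv hu => ?_
  rcases (mem_touching_of_ends huv).1 he with h | h
  · exact hR e u v huv h
  · exact Or.inl h

theorem not_mem_of_conn_outer {x y : V} (hx : x ∉ R) (h : (G.outer R).Conn ω x y) : y ∉ R :=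
  conn_restrict_induction (P := fun y => y ∉ R) h hx fun _ he _ _ _ huv _ hv =>
    he ((mem_touching_of_ends huv).2 (Or.inr hv))

/-- The relation of being connected within one of the two parts of `G`. -/
def PartConn (G : PercGraph V E) (R : Set V) (ω : E → Bool) (x y : V) : Prop :=
  (G.inner R).Conn ω x y ∨ (G.outer R).Conn ω x y

theorem PartConn.conn {x y : V} (h : G.PartConn R ω x y) : G.Conn ω x y :=
  h.elim Conn.of_restrict Conn.of_restrict

theorem PartConn.refl (x : V) : G.PartConn R ω x x := Or.inl Relation.ReflTransGen.refl

theorem Encloses.exists_of_conn (hR : G.Encloses A R) (hA : ∀ a ∈ A, a ∉ R) {i v : V}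
    (hi : i ∈ A) (h : G.Conn ω i v) :
    ∃ j ∈ A, Relation.ReflTransGen (fun x y => y ∈ A ∧ G.PartConn R ω x y) i j ∧
      G.PartConn R ω j v := by
  induction h with
  | refl => exact ⟨i, hi, Relation.ReflTransGen.refl, PartConn.refl i⟩
  | @tail u v _ huv ih =>
    obtain ⟨e, he, huv⟩ := huv
    obtain ⟨j, hj, hL, hju⟩ := ih
    have step (hu : u ∈ A) (h : G.PartConn R ω u v) :
        ∃ j ∈ A, Relation.ReflTransGen (fun x y => y ∈ A ∧ G.PartConn R ω x y) i j ∧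
          G.PartConn R ω j v := ⟨u, hu, hL.tail ⟨hu, hju⟩, h⟩
    by_cases heM : e ∈ G.touching R
    · rcases hju with h | h
      · exact ⟨j, hj, hL, Or.inl (Conn.restrict_tail h heM he huv)⟩
      · refine step ?_ (Or.inl (Conn.restrict_tail Relation.ReflTransGen.refl heM he huv))
        have hu := not_mem_of_conn_outer (hA j hj) h
        have hv := ((mem_touching_of_ends huv).1 heM).resolve_left hu
        exact (hR e v u huv.symm hv).resolve_left hu
    · rcases hju with h | h
      · refine step ?_ (Or.inr (Conn.restrict_tail Relation.ReflTransGen.refl heM he huv))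
        refine (hR.mem_of_conn_inner (Or.inr hj) h).resolve_left fun hu => ?_
        exact heM ((mem_touching_of_ends huv).2 (Or.inl hu))
      · exact ⟨j, hj, hL, Or.inr (Conn.restrict_tail h heM he huv)⟩

theorem Encloses.exists_of_conn_of_mem (hR : G.Encloses A R) {x v : V} (hx : x ∈ R)
    (h : G.Conn ω x v) :
    (G.inner R).Conn ω x v ∨ ∃ i ∈ A, (G.inner R).Conn ω x i ∧ G.Conn ω i v := by
  induction h with
  | refl => exact Or.inl Relation.ReflTransGen.refl
  | @tail u v _ huv ih =>
    rcases ih with h | ⟨i, hi, h, h'⟩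
    · obtain ⟨e, he, huv⟩ := huv
      by_cases heM : e ∈ G.touching R
      · exact Or.inl (Conn.restrict_tail h heM he huv)
      · refine Or.inr ⟨u, ?_, h, Relation.ReflTransGen.single ⟨e, he, huv⟩⟩
        refine (hR.mem_of_conn_inner (Or.inl hx) h).resolve_left fun hu => ?_
        exact heM ((mem_touching_of_ends huv).2 (Or.inl hu))
    · exact Or.inr ⟨i, hi, h, h'.tail huv⟩

theorem Encloses.conn_iff (hR : G.Encloses A R) {x b : V} (hx : x ∈ R) (hb : b ∉ R) :
    G.Conn ω x b ↔ ∃ i ∈ A, (G.inner R).Conn ω x i ∧ G.Conn ω i b := by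
  constructor
  · intro h
    rcases hR.exists_of_conn_of_mem hx h with h | h
    · exact ⟨b, (hR.mem_of_conn_inner (Or.inl hx) h).resolve_left hb, h,
        Relation.ReflTransGen.refl⟩
    · exact h
  · rintro ⟨i, _, h, h'⟩
    exact (Conn.of_restrict h).trans h'

theorem Encloses.exists_conn_iff (hR : G.Encloses A R) {x : V} (hx : x ∈ R) :
    (∃ i ∈ A, G.Conn ω x i) ↔ ∃ i ∈ A, (G.inner R).Conn ω x i := by
  constructor
  · rintro ⟨i, hi, h⟩
    rcases hR.exists_of_conn_of_mem hx h with h | ⟨j, hj, h, _⟩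
    · exact ⟨i, hi, h⟩
    · exact ⟨j, hj, h⟩
  · rintro ⟨i, hi, h⟩
    exact ⟨i, hi, Conn.of_restrict h⟩

/-- On three points, a reflexive relation generates its transitive closure in two steps. -/
theorem exists_mid_of_reflTransGen {A : Set V} {r : V → V → Prop} (hr : ∀ x, r x x)
    {a₁ a₂ a₃ i j : V} (hA : A = {a₁, a₂, a₃}) (hi : i ∈ A)
    (h : Relation.ReflTransGen (fun x y => y ∈ A ∧ r x y) i j) :
    j ∈ A ∧ ∃ k ∈ A, r i k ∧ r k j := by
  induction h with
  | refl => exact ⟨hi, i, hi, hr i, hr i⟩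
  | @tail v w _ hvw ih =>
    obtain ⟨hv, k, hk, hik, hkv⟩ := ih
    obtain ⟨hw, hvw⟩ := hvw
    refine ⟨hw, ?_⟩
    have : i = k ∨ i = v ∨ i = w ∨ k = v ∨ k = w ∨ v = w := by
      rw [hA] at hi hv hk hw
      simp only [Set.mem_insert_iff, Set.mem_singleton_iff] at hi hv hk hw
      grind
    rcases this with rfl | rfl | rfl | rfl | rfl | rfl
    · exact ⟨v, hv, hkv, hvw⟩
    · exact ⟨i, hi, hr i, hvw⟩
    · exact ⟨i, hi, hr i, hr i⟩
    · exact ⟨k, hk, hik, hvw⟩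
    · exact ⟨k, hk, hik, hr k⟩
    · exact ⟨k, hk, hik, hkv⟩

theorem Encloses.conn_iff_exists (hR : G.Encloses A R) (hA : ∀ a ∈ A, a ∉ R) {a₁ a₂ a₃ i b : V}
    (hA' : A = {a₁, a₂, a₃}) (hi : i ∈ A) (hb : b ∉ R) :
    G.Conn ω i b ↔ ∃ k ∈ A, ∃ j ∈ A, G.PartConn R ω i k ∧ G.PartConn R ω k j ∧
      (G.outer R).Conn ω b j := by
  constructor
  · intro h
    obtain ⟨j, hj, hij, hjb⟩ := hR.exists_of_conn hA hi h
    rcases hjb with h | h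
    · have hbA := (hR.mem_of_conn_inner (Or.inr hj) h).resolve_left hb
      obtain ⟨_, k, hk, hik, hkb⟩ :=
        exists_mid_of_reflTransGen PartConn.refl hA' hi (hij.tail ⟨hbA, Or.inl h⟩)
      exact ⟨k, hk, b, hbA, hik, hkb, Relation.ReflTransGen.refl⟩
    · obtain ⟨_, k, hk, hik, hkj⟩ := exists_mid_of_reflTransGen PartConn.refl hA' hi hij
      exact ⟨k, hk, j, hj, hik, hkj, h.symm⟩
  · rintro ⟨k, _, j, _, hik, hkj, h⟩
    exact hik.conn.trans (hkj.conn.trans (Conn.of_restrict h).symm)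

end Separation

section Decomposition

variable {V E : Type} {G : PercGraph V E}

/-- The partition identity behind `gap`, for truth values: `oᵢ`, `pᵢⱼ` describe the partition of
`0` and the three points on one side, `bᵢ`, `qᵢⱼ` that of `b` and the three points on the other. -/
theorem int_gap_eq : ∀ o₁ o₂ o₃ p₁₂ p₁₃ p₂₃ : Bool,
    ((o₁ && o₂) ≤ p₁₂ ∧ (o₁ && o₃) ≤ p₁₃ ∧ (o₂ && o₃) ≤ p₂₃ ∧ (o₁ && p₁₂) ≤ o₂ ∧
      (o₂ && p₁₂) ≤ o₁ ∧ (o₁ && p₁₃) ≤ o₃ ∧ (o₃ && p₁₃) ≤ o₁ ∧ (o₂ && p₂₃) ≤ o₃ ∧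
      (o₃ && p₂₃) ≤ o₂ ∧ (p₁₂ && p₁₃) ≤ p₂₃ ∧ (p₁₂ && p₂₃) ≤ p₁₃ ∧ (p₁₃ && p₂₃) ≤ p₁₂) →
    ∀ b₁ b₂ b₃ q₁₂ q₁₃ q₂₃ : Bool,
    ((b₁ && b₂) ≤ q₁₂ ∧ (b₁ && b₃) ≤ q₁₃ ∧ (b₂ && b₃) ≤ q₂₃ ∧ (b₁ && q₁₂) ≤ b₂ ∧
      (b₂ && q₁₂) ≤ b₁ ∧ (b₁ && q₁₃) ≤ b₃ ∧ (b₃ && q₁₃) ≤ b₁ ∧ (b₂ && q₂₃) ≤ b₃ ∧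
      (b₃ && q₂₃) ≤ b₂ ∧ (q₁₂ && q₁₃) ≤ q₂₃ ∧ (q₁₂ && q₂₃) ≤ q₁₃ ∧ (q₁₃ && q₂₃) ≤ q₁₂) →
    let e₁₂ := p₁₂ || q₁₂
    let e₁₃ := p₁₃ || q₁₃
    let e₂₃ := p₂₃ || q₂₃
    let c₁ := b₁ || (e₁₂ || e₁₃ && e₂₃) && b₂ || (e₁₃ || e₁₂ && e₂₃) && b₃
    let c₂ := b₂ || (e₁₂ || e₂₃ && e₁₃) && b₁ || (e₂₃ || e₁₂ && e₁₃) && b₃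
    let c₃ := b₃ || (e₁₃ || e₂₃ && e₁₂) && b₁ || (e₂₃ || e₁₃ && e₁₂) && b₂
    let x₂ := (o₂ && !o₁ && !o₃ && !p₁₃).toInt
    let x₃ := (o₃ && !o₁ && !o₂ && !p₁₂).toInt
    let y₂ := (o₂ && !o₁ && !o₃ && p₁₃).toInt
    let y₃ := (o₃ && !o₁ && !o₂ && p₁₂).toInt
    let z₁ := (!o₁ && o₂ && o₃).toInt
    let β₁ := (b₁ && !b₂ && !b₃ && !q₂₃).toInt
    let β₂ := (b₂ && !b₁ && !b₃ && !q₁₃).toInt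
    let β₃ := (b₃ && !b₁ && !b₂ && !q₁₂).toInt
    let γ₁ := (b₁ && !b₂ && !b₃ && q₂₃).toInt
    let γ₂ := (b₂ && !b₁ && !b₃ && q₁₃).toInt
    let γ₃ := (b₃ && !b₁ && !b₂ && q₁₂).toInt
    let δ₁ := (!b₁ && b₂ && b₃).toInt
    let δ₂ := (!b₂ && b₁ && b₃).toInt
    let δ₃ := (!b₃ && b₁ && b₂).toInt
    (o₁ && c₁ || o₂ && c₂ || o₃ && c₃).toInt - ((o₁ || o₂ || o₃) && c₁).toInt =
      x₂ * ((β₂ + γ₂ - δ₂) - (β₁ + γ₁ - δ₁)) + x₃ * ((β₃ + γ₃ - δ₃) - (β₁ + γ₁ - δ₁)) +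
        y₂ * (β₂ + γ₂ - δ₂ - β₁ - β₃) + y₃ * (β₃ + γ₃ - δ₃ - β₁ - β₂) -
        z₁ * (β₁ + γ₁ - δ₁ - β₂ - β₃) := by
  decide +kernel

theorem ind_eq_toInt {P : Prop} {c : Bool} (h : c = true ↔ P) : ind P = (c.toInt : ℝ) := by
  cases c
  · rw [ind_of_not fun hP => by simpa using h.2 hP]; simp
  · rw [ind_of (h.1 rfl)]; simp

open Classical in
theorem decide_conn_consistent (ω : E → Bool) (o a₁ a₂ a₃ : V) :
    (decide (G.Conn ω o a₁) && decide (G.Conn ω o a₂)) ≤ decide (G.Conn ω a₁ a₂) ∧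
    (decide (G.Conn ω o a₁) && decide (G.Conn ω o a₃)) ≤ decide (G.Conn ω a₁ a₃) ∧
    (decide (G.Conn ω o a₂) && decide (G.Conn ω o a₃)) ≤ decide (G.Conn ω a₂ a₃) ∧
    (decide (G.Conn ω o a₁) && decide (G.Conn ω a₁ a₂)) ≤ decide (G.Conn ω o a₂) ∧
    (decide (G.Conn ω o a₂) && decide (G.Conn ω a₁ a₂)) ≤ decide (G.Conn ω o a₁) ∧
    (decide (G.Conn ω o a₁) && decide (G.Conn ω a₁ a₃)) ≤ decide (G.Conn ω o a₃) ∧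
    (decide (G.Conn ω o a₃) && decide (G.Conn ω a₁ a₃)) ≤ decide (G.Conn ω o a₁) ∧
    (decide (G.Conn ω o a₂) && decide (G.Conn ω a₂ a₃)) ≤ decide (G.Conn ω o a₃) ∧
    (decide (G.Conn ω o a₃) && decide (G.Conn ω a₂ a₃)) ≤ decide (G.Conn ω o a₂) ∧
    (decide (G.Conn ω a₁ a₂) && decide (G.Conn ω a₁ a₃)) ≤ decide (G.Conn ω a₂ a₃) ∧
    (decide (G.Conn ω a₁ a₂) && decide (G.Conn ω a₂ a₃)) ≤ decide (G.Conn ω a₁ a₃) ∧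
    (decide (G.Conn ω a₁ a₃) && decide (G.Conn ω a₂ a₃)) ≤ decide (G.Conn ω a₁ a₂) := by
  have key {P Q S : Prop} (h : P → Q → S) : (decide P && decide Q) ≤ decide S := by
    by_cases hP : P <;> by_cases hQ : Q <;> simp [hP, hQ]
    exact (decide_eq_true (h hP hQ)).ge
  exact ⟨key fun h h' => h.symm.trans h', key fun h h' => h.symm.trans h',
    key fun h h' => h.symm.trans h', key fun h h' => h.trans h', key fun h h' => h.trans h'.symm,
    key fun h h' => h.trans h', key fun h h' => h.trans h'.symm, key fun h h' => h.trans h',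
    key fun h h' => h.trans h'.symm, key fun h h' => h.symm.trans h', key fun h h' => h.trans h',
    key fun h h' => h.trans h'.symm⟩

theorem partConn_comm {R : Set V} {ω : E → Bool} {x y : V} :
    G.PartConn R ω x y ↔ G.PartConn R ω y x := or_congr conn_comm conn_comm

variable {A R : Set V} {a₁ a₂ a₃ x b : V}

theorem Encloses.conn_iff_of_eq_triple (hR : G.Encloses A R) (hAR : ∀ a ∈ A, a ∉ R) {i j k : V}
    (hA : A = {i, j, k}) (hb : b ∉ R) {ω : E → Bool} :
    G.Conn ω i b ↔ (G.outer R).Conn ω b i ∨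
      (G.PartConn R ω i j ∨ G.PartConn R ω i k ∧ G.PartConn R ω j k) ∧ (G.outer R).Conn ω b j ∨
      (G.PartConn R ω i k ∨ G.PartConn R ω i j ∧ G.PartConn R ω j k) ∧
        (G.outer R).Conn ω b k := by
  rw [hR.conn_iff_exists hAR hA (by simp [hA]) hb]
  simp only [hA, Set.mem_insert_iff, Set.mem_singleton_iff, exists_eq_or_imp, exists_eq_left,
    PartConn.refl, partConn_comm (x := j) (y := i), partConn_comm (x := k) (y := i),
    partConn_comm (x := k) (y := j), true_and]
  tauto

theorem Encloses.ind_sub_ind (hR : G.Encloses A R) (hAR : ∀ a ∈ A, a ∉ R)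
    (hA : A = {a₁, a₂, a₃}) (hx : x ∈ R) (hb : b ∉ R) (ω : E → Bool) :
    ind (ω ∈ G.connEvent x b ∩ G.connTo x A) - ind (ω ∈ G.connTo x A ∩ G.connEvent a₁ b) =
      gap (ind ((G.inner R).Sole x a₂ a₁ a₃ ω)) (ind ((G.inner R).Sole x a₃ a₁ a₂ ω))
        (ind ((G.inner R).Paired x a₂ a₁ a₃ ω)) (ind ((G.inner R).Paired x a₃ a₁ a₂ ω))
        (ind ((G.inner R).Missing x a₁ a₂ a₃ ω))
        (ind ((G.outer R).Sole b a₁ a₂ a₃ ω)) (ind ((G.outer R).Sole b a₂ a₁ a₃ ω))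
        (ind ((G.outer R).Sole b a₃ a₁ a₂ ω))
        (ind ((G.outer R).Paired b a₁ a₂ a₃ ω)) (ind ((G.outer R).Paired b a₂ a₁ a₃ ω))
        (ind ((G.outer R).Paired b a₃ a₁ a₂ ω))
        (ind ((G.outer R).Missing b a₁ a₂ a₃ ω)) (ind ((G.outer R).Missing b a₂ a₁ a₃ ω))
        (ind ((G.outer R).Missing b a₃ a₁ a₂ ω)) := by
  classical
  have key := int_gap_eq _ _ _ _ _ _ (decide_conn_consistent (G := G.inner R) ω x a₁ a₂ a₃)
    _ _ _ _ _ _ (decide_conn_consistent (G := G.outer R) ω b a₁ a₂ a₃)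
  have c₁ := hR.conn_iff_of_eq_triple (ω := ω) hAR hA hb
  have c₂ := hR.conn_iff_of_eq_triple (ω := ω) (i := a₂) (j := a₁) (k := a₃) hAR
    (by rw [hA, Set.insert_comm]) hb
  have c₃ := hR.conn_iff_of_eq_triple (ω := ω) (i := a₃) (j := a₁) (k := a₂) hAR
    (by rw [hA, Set.pair_comm, Set.insert_comm]) hb
  have cA := hR.exists_conn_iff (ω := ω) hx
  have cx := hR.conn_iff (ω := ω) hx hb
  simp only [hA, Set.mem_insert_iff, Set.mem_singleton_iff, exists_eq_or_imp, exists_eq_left,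
    partConn_comm (x := a₂) (y := a₁), partConn_comm (x := a₃) (y := a₁),
    partConn_comm (x := a₃) (y := a₂)] at c₂ c₃ cA cx
  have cxA : G.Conn ω x b → G.Conn ω x a₁ ∨ G.Conn ω x a₂ ∨ G.Conn ω x a₃ := fun h =>
    cA.2 ((cx.1 h).imp And.left (Or.imp And.left And.left))
  have l : ω ∈ G.connEvent x b ∩ G.connTo x A ↔ G.Conn ω x b := by
    simp only [Set.mem_inter_iff, connEvent, connTo, Set.mem_ofPred_eq, hA, Set.mem_insert_iff,
      Set.mem_singleton_iff, exists_eq_or_imp, exists_eq_left]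
    exact and_iff_left_of_imp cxA
  have r : ω ∈ G.connTo x A ∩ G.connEvent a₁ b ↔ ((G.inner R).Conn ω x a₁ ∨
      (G.inner R).Conn ω x a₂ ∨ (G.inner R).Conn ω x a₃) ∧ G.Conn ω a₁ b := by
    simp only [Set.mem_inter_iff, connEvent, connTo, Set.mem_ofPred_eq, hA, Set.mem_insert_iff,
      Set.mem_singleton_iff, exists_eq_or_imp, exists_eq_left, cA]
  rw [l, r, cx, c₁, c₂, c₃]
  have key' := congrArg (Int.cast (R := ℝ)) key
  push_cast at key'
  unfold gap
  convert key' <;> refine ind_eq_toInt ?_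
  all_goals simp only [Sole, Paired, Missing, PartConn, Bool.or_eq_true, Bool.and_eq_true,
    decide_eq_true_eq, Bool.not_eq_true', decide_eq_false_iff_not, and_assoc, or_assoc]

end Decomposition

section Comparison

variable {V E : Type} [Fintype E] [DecidableEq E] {G : PercGraph V E} {A R : Set V}
  {a₁ a₂ a₃ x b : V}

/-- The probability of `Sole`. -/
noncomputable def soleProb (G : PercGraph V E) (o i j k : V) : ℝ :=
  G.expec fun ω => ind (G.Sole o i j k ω)

/-- The probability of `Paired`. -/
noncomputable def pairedProb (G : PercGraph V E) (o i j k : V) : ℝ :=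
  G.expec fun ω => ind (G.Paired o i j k ω)

/-- The probability of `Missing`. -/
noncomputable def missingProb (G : PercGraph V E) (o i j k : V) : ℝ :=
  G.expec fun ω => ind (G.Missing o i j k ω)

theorem soleProb_comm (o i j k : V) : G.soleProb o i j k = G.soleProb o i k j := by
  unfold soleProb Sole
  simp only [conn_comm (x := k) (y := j), and_left_comm]

theorem pairedProb_comm (o i j k : V) : G.pairedProb o i j k = G.pairedProb o i k j := by
  unfold pairedProb Paired
  simp only [conn_comm (x := k) (y := j), and_left_comm]

theorem missingProb_comm (o i j k : V) : G.missingProb o i j k = G.missingProb o i k j := by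
  unfold missingProb Missing
  simp only [and_comm (b := G.Conn _ o j)]

theorem expec_gap (M : Set E) {x₂ x₃ y₂ y₃ z₁ β₁ β₂ β₃ γ₁ γ₂ γ₃ δ₁ δ₂ δ₃ : (E → Bool) → ℝ}
    (hx₂ : ∀ η ω, x₂ (mix M η ω) = x₂ η) (hx₃ : ∀ η ω, x₃ (mix M η ω) = x₃ η)
    (hy₂ : ∀ η ω, y₂ (mix M η ω) = y₂ η) (hy₃ : ∀ η ω, y₃ (mix M η ω) = y₃ η)
    (hz₁ : ∀ η ω, z₁ (mix M η ω) = z₁ η) (hβ₁ : ∀ η ω, β₁ (mix M η ω) = β₁ ω)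
    (hβ₂ : ∀ η ω, β₂ (mix M η ω) = β₂ ω) (hβ₃ : ∀ η ω, β₃ (mix M η ω) = β₃ ω)
    (hγ₁ : ∀ η ω, γ₁ (mix M η ω) = γ₁ ω) (hγ₂ : ∀ η ω, γ₂ (mix M η ω) = γ₂ ω)
    (hγ₃ : ∀ η ω, γ₃ (mix M η ω) = γ₃ ω) (hδ₁ : ∀ η ω, δ₁ (mix M η ω) = δ₁ ω)
    (hδ₂ : ∀ η ω, δ₂ (mix M η ω) = δ₂ ω) (hδ₃ : ∀ η ω, δ₃ (mix M η ω) = δ₃ ω) :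
    G.expec (fun ω => gap (x₂ ω) (x₃ ω) (y₂ ω) (y₃ ω) (z₁ ω) (β₁ ω) (β₂ ω) (β₃ ω)
      (γ₁ ω) (γ₂ ω) (γ₃ ω) (δ₁ ω) (δ₂ ω) (δ₃ ω)) =
    gap (G.expec x₂) (G.expec x₃) (G.expec y₂) (G.expec y₃) (G.expec z₁)
      (G.expec β₁) (G.expec β₂) (G.expec β₃) (G.expec γ₁) (G.expec γ₂) (G.expec γ₃)
      (G.expec δ₁) (G.expec δ₂) (G.expec δ₃) := by
  unfold gap
  rw [expec_sub, expec_add, expec_add, expec_add]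
  rw [expec_mul_of_disjoint G M hx₂ (by intro η ω; simp only [hβ₁, hβ₂, hγ₁, hγ₂, hδ₁, hδ₂]),
    expec_mul_of_disjoint G M hx₃ (by intro η ω; simp only [hβ₁, hβ₃, hγ₁, hγ₃, hδ₁, hδ₃]),
    expec_mul_of_disjoint G M hy₂ (by intro η ω; simp only [hβ₁, hβ₂, hβ₃, hγ₂, hδ₂]),
    expec_mul_of_disjoint G M hy₃ (by intro η ω; simp only [hβ₁, hβ₂, hβ₃, hγ₃, hδ₃]),
    expec_mul_of_disjoint G M hz₁ (by intro η ω; simp only [hβ₁, hβ₂, hβ₃, hγ₁, hδ₁])]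
  simp only [expec_sub, expec_add]

theorem Encloses.prob_sub_prob (hR : G.Encloses A R) (hAR : ∀ a ∈ A, a ∉ R)
    (hA : A = {a₁, a₂, a₃}) (hx : x ∈ R) (hb : b ∉ R) :
    G.prob (G.connEvent x b ∩ G.connTo x A) - G.prob (G.connTo x A ∩ G.connEvent a₁ b) =
      gap ((G.inner R).soleProb x a₂ a₁ a₃) ((G.inner R).soleProb x a₃ a₁ a₂)
        ((G.inner R).pairedProb x a₂ a₁ a₃) ((G.inner R).pairedProb x a₃ a₁ a₂)
        ((G.inner R).missingProb x a₁ a₂ a₃)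
        ((G.outer R).soleProb b a₁ a₂ a₃) ((G.outer R).soleProb b a₂ a₁ a₃)
        ((G.outer R).soleProb b a₃ a₁ a₂)
        ((G.outer R).pairedProb b a₁ a₂ a₃) ((G.outer R).pairedProb b a₂ a₁ a₃)
        ((G.outer R).pairedProb b a₃ a₁ a₂)
        ((G.outer R).missingProb b a₁ a₂ a₃) ((G.outer R).missingProb b a₂ a₁ a₃)
        ((G.outer R).missingProb b a₃ a₁ a₂) := by
  rw [prob_eq_expec, prob_eq_expec, ← expec_sub]
  simp only [hR.ind_sub_ind hAR hA hx hb]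
  refine expec_gap (G.touching R) ?_ ?_ ?_ ?_ ?_ ?_ ?_ ?_ ?_ ?_ ?_ ?_ ?_ ?_ <;>
    intro η ω <;>
    simp only [Sole, Paired, Missing, inner, outer, conn_restrict_mix, conn_restrict_compl_mix]

theorem Encloses.exists_prob_le_of_pos (hR : G.Encloses A R) (hp : G.ProbValid)
    (hw : 0 < G.weight ⊥) (hAR : ∀ a ∈ A, a ∉ R) (h₁₂ : a₁ ≠ a₂) (h₁₃ : a₁ ≠ a₃) (h₂₃ : a₂ ≠ a₃)
    (hA : A = {a₁, a₂, a₃}) (hx : x ∈ R) (hb : b ∉ R) :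
    ∃ a ∈ A, G.prob (G.connTo x A ∩ G.connEvent a b) ≤
      G.prob (G.connEvent x b ∩ G.connTo x A) := by
  have nn (H : PercGraph V E) (hp : H.ProbValid) (P : (E → Bool) → Prop) :
      0 ≤ H.expec fun ω => ind (P ω) := expec_nonneg hp fun _ => ind_nonneg _
  have sole_le (H : PercGraph V E) (hp : H.ProbValid) (hw : 0 < H.weight ⊥) (o : V) {i j k : V}
      (hij : i ≠ j) (hik : i ≠ k) : H.pairedProb o i j k * (H.soleProb o j i k +
        H.soleProb o k i j) ≤ H.soleProb o i j k * H.missingProb o i j k :=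
    expec_paired_mul_le hp hw o hij hik
  have paired_le (H : PercGraph V E) (hp : H.ProbValid) (o : V) {i j k : V}
      (hjk : j ≠ k) : H.weight ⊥ * H.pairedProb o i j k ≤ H.soleProb o i j k :=
    mul_expec_paired_le hp o hjk
  have hp₀ : (G.inner R).ProbValid := hp
  have hp₁ : (G.outer R).ProbValid := hp
  have e₁ := hR.prob_sub_prob hAR hA hx hb
  have e₂ := hR.prob_sub_prob (a₁ := a₂) (a₂ := a₁) (a₃ := a₃) hAR
    (by rw [hA, Set.insert_comm]) hx hb
  have e₃ := hR.prob_sub_prob (a₁ := a₃) (a₂ := a₁) (a₃ := a₂) hAR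
    (by rw [hA, Set.pair_comm, Set.insert_comm]) hx hb
  have i₁ := sole_le _ hp₀ hw x h₁₂ h₁₃
  have i₂ := sole_le _ hp₀ hw x h₁₂.symm h₂₃
  have i₃ := sole_le _ hp₀ hw x h₁₃.symm h₂₃.symm
  have o₁ := sole_le _ hp₁ hw b h₁₂ h₁₃
  have o₂ := sole_le _ hp₁ hw b h₁₂.symm h₂₃
  have o₃ := sole_le _ hp₁ hw b h₁₃.symm h₂₃.symm
  simp only [soleProb_comm _ a₁ a₃ a₂, soleProb_comm _ a₂ a₃ a₁, soleProb_comm _ a₃ a₂ a₁,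
    pairedProb_comm _ a₁ a₃ a₂, pairedProb_comm _ a₂ a₃ a₁, pairedProb_comm _ a₃ a₂ a₁,
    missingProb_comm _ a₁ a₃ a₂, missingProb_comm _ a₂ a₃ a₁, missingProb_comm _ a₃ a₂ a₁]
    at e₂ e₃ i₁ i₂ i₃ o₁ o₂ o₃
  have key := exists_gap_nonneg (ε := G.weight ⊥) hw (nn _ hp₀ _) (nn _ hp₀ _) (nn _ hp₀ _)
    (nn _ hp₀ _) (nn _ hp₀ _) (nn _ hp₀ _) (nn _ hp₀ _) (nn _ hp₀ _) (nn _ hp₁ _) (nn _ hp₁ _)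
    (nn _ hp₁ _) (nn _ hp₁ _) (nn _ hp₁ _) (nn _ hp₁ _)
    (paired_le _ hp₀ x h₁₃) (paired_le _ hp₀ x h₁₂) (paired_le _ hp₁ b h₂₃)
    (paired_le _ hp₁ b h₁₃) (paired_le _ hp₁ b h₁₂) i₁ i₂ i₃ o₁ o₂ o₃
  rcases key with h | h | h
  · exact ⟨a₁, by simp [hA], sub_nonneg.1 (h.trans_eq e₁.symm)⟩
  · exact ⟨a₂, by simp [hA], sub_nonneg.1 (h.trans_eq e₂.symm)⟩
  · exact ⟨a₃, by simp [hA], sub_nonneg.1 (h.trans_eq e₃.symm)⟩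

/-- The graph `G` with all edge probabilities multiplied by `1 - t`. -/
def thin (G : PercGraph V E) (t : ℝ) : PercGraph V E := ⟨G.ends, fun e => (1 - t) * G.p e⟩

theorem thin_zero (G : PercGraph V E) : G.thin 0 = G := by simp [thin]

theorem continuous_prob_thin (G : PercGraph V E) (S : Set (E → Bool)) :
    Continuous fun t => (G.thin t).prob S := by
  simp only [prob_eq_expec, expec, weight, thin]
  refine continuous_finsetSum _ fun ω _ => continuous_const.mul
    (continuous_finsetProd _ fun e _ => ?_)
  split_ifs <;> fun_prop

theorem thin_probValid (hp : G.ProbValid) {t : ℝ} (h0 : 0 ≤ t) (h1 : t ≤ 1) :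
    (G.thin t).ProbValid := fun e =>
  ⟨mul_nonneg (sub_nonneg.2 h1) (hp e).1, mul_le_one₀ (by linarith) (hp e).1 (hp e).2⟩

theorem weight_thin_bot_pos (hp : G.ProbValid) {t : ℝ} (h0 : 0 < t) (h1 : t ≤ 1) :
    0 < (G.thin t).weight ⊥ := by
  refine Finset.prod_pos fun e _ => ?_
  have := mul_le_mul_of_nonneg_left (hp e).2 (sub_nonneg.2 h1)
  simp only [thin, Pi.bot_apply, bot_eq_false, Bool.false_eq_true, if_false]
  linarith

theorem Encloses.exists_prob_le {A : Finset V} (hR : G.Encloses ↑A R) (hp : G.ProbValid)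
    (hAR : ∀ a ∈ A, a ∉ R) (hA : A.card = 3) (hx : x ∈ R) (hb : b ∉ R) :
    ∃ a ∈ A, G.prob (G.connTo x ↑A ∩ G.connEvent a b) ≤
      G.prob (G.connEvent x b ∩ G.connTo x ↑A) := by
  classical
  obtain ⟨a₁, a₂, a₃, h₁₂, h₁₃, h₂₃, hA⟩ := Finset.card_eq_three.1 hA
  by_contra! hlt
  have hev : ∀ᶠ t in nhdsWithin (0 : ℝ) (Set.Ioi 0), ∀ a ∈ A,
      (G.thin t).prob (G.connEvent x b ∩ G.connTo x ↑A) <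
        (G.thin t).prob (G.connTo x ↑A ∩ G.connEvent a b) := by
    refine (Filter.eventually_all_finset A).2 fun a ha => ?_
    refine Filter.Eventually.filter_mono nhdsWithin_le_nhds ?_
    refine (continuous_prob_thin G _).continuousAt.eventually_lt
      (continuous_prob_thin G _).continuousAt ?_
    rw [thin_zero]
    exact hlt a ha
  obtain ⟨t, ht, ht0, ht1⟩ := (hev.and (Ioc_mem_nhdsGT one_pos)).exists
  obtain ⟨a, ha, hle⟩ := Encloses.exists_prob_le_of_pos (G := G.thin t) hR
    (thin_probValid hp ht0.le ht1) (weight_thin_bot_pos hp ht0 ht1) hAR h₁₂ h₁₃ h₂₃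
    (by simp [hA]) hx hb
  exact (ht a ha).not_ge hle

end Comparison

end PercGraph

/-- pre-FKG inequality when `|A| = 3` and `A` separates `0` from `b`
(every path in `G` from `0` to `b` passes through a vertex of `A`). -/
theorem preFKG_three_separating
    {V E : Type} [DecidableEq V] [Fintype E] [DecidableEq E]
    (G : PercGraph V E) (hp : G.ProbValid) (A : Finset V) (hA : A.card = 3)
    (x₀ b : V)
    (hsep : ¬ Relation.ReflTransGen
        (fun x y => x ∉ A ∧ y ∉ A ∧ ∃ e, G.ends e = (x, y) ∨ G.ends e = (y, x))
        x₀ b) :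
    A.inf' (Finset.card_pos.mp (by omega))
        (fun a => G.prob (G.connTo x₀ ↑A ∩ G.connEvent a b))
      ≤ G.prob (G.connEvent x₀ b ∩ G.connTo x₀ ↑A) := by
  suffices h : ∃ a ∈ A, G.prob (G.connTo x₀ ↑A ∩ G.connEvent a b) ≤
      G.prob (G.connEvent x₀ b ∩ G.connTo x₀ ↑A) by
    obtain ⟨a, ha, h⟩ := h
    exact (Finset.inf'_le _ ha).trans h
  by_cases hx : x₀ ∈ A
  · exact ⟨x₀, hx, by rw [Set.inter_comm]⟩
  let R : Set V := {v | v ∉ A ∧ Relation.ReflTransGen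
    (fun x y => x ∉ A ∧ y ∉ A ∧ ∃ e, G.ends e = (x, y) ∨ G.ends e = (y, x)) x₀ v}
  have hR : G.Encloses ↑A R := by
    rintro e u v huv ⟨hu, hxu⟩
    by_cases hv : v ∈ A
    · exact Or.inr hv
    · exact Or.inl ⟨hv, hxu.tail ⟨hu, hv, e, huv⟩⟩
  exact hR.exists_prob_le hp (fun a ha h => h.1 ha) hA ⟨hx, Relation.ReflTransGen.refl⟩
    fun h => hsep h.2
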